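/- Uniform spatial Lipschitz bound: Assume σ ∈ C²(ℝⁿ \ {0}) is convex, g ∈ C(S^{n−1} × ℝ) satisfies |g(p,ξ₁) − g(p,ξ₂)| ≤ L_g |ξ₁ − ξ₂| for all p ∈ S^{n−1} and ξ₁, ξ₂ ∈ ℝ and is non-decreasing in its second variable, and f ∈ C(ℝⁿ × [0,T]) satisfies |f(x,t) − f(y,t)| ≤ L_f |x−y| for all x, y and t. Let u ∈ C(ℝⁿ × [0,T]) be a viscosity solution of the level-set equation (E) on ℝⁿ × (0,T) that is constant outside B × [0,T] for some (large) ball B. If the initial datum u₀ := u(·,0) is Lipschitz continuous with Lipschitz constant L, then |u(x,t) − u(y,t)| ≤ L e^{Mt} |x−y| for all x, y ∈ ℝⁿ and t ∈ [0,T], where M = L_g L_f. -/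

import Mathlib

open MeasureTheory Set Filter Metric
open scoped RealInnerProductSpace ENNReal Topology NNReal

noncomputable section

namespace Paper

abbrev E (n : ℕ) := EuclideanSpace ℝ (Fin n)

/-- trace of the composition of two endomorphisms. -/
def trComp {n : ℕ} (A B : E n →L[ℝ] E n) : ℝ :=
  LinearMap.trace ℝ (E n) (A.comp B).toLinearMap

/-- Hessian of `φ` at `x` as a continuous linear endomorphism. -/
def hessian {n : ℕ} (φ : E n → ℝ) (x : E n) : E n →L[ℝ] E n :=
  fderiv ℝ (gradient φ) x

/-- Lower semicontinuous envelope in the variables `(p, X)`, taken over `p ≠ 0`. -/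
def lowerEnvPX {n : ℕ} (H : E n → (E n →L[ℝ] E n) → ℝ) (p : E n)
    (X : E n →L[ℝ] E n) : EReal :=
  Filter.liminf (fun q : E n × (E n →L[ℝ] E n) => ((H q.1 q.2 : ℝ) : EReal))
    (nhdsWithin (p, X) {q | q.1 ≠ 0})

/-- Upper semicontinuous envelope in the variables `(p, X)`, taken over `p ≠ 0`. -/
def upperEnvPX {n : ℕ} (H : E n → (E n →L[ℝ] E n) → ℝ) (p : E n)
    (X : E n →L[ℝ] E n) : EReal :=
  Filter.limsup (fun q : E n × (E n →L[ℝ] E n) => ((H q.1 q.2 : ℝ) : EReal))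
    (nhdsWithin (p, X) {q | q.1 ≠ 0})

/-- Standard parabolic viscosity subsolution condition for
`u_t + G(x, t, ∇u, ∇²u) ≤ 0` on `D`, with test functions `C²` in space, `C¹` in time. -/
def StdSubCond {n : ℕ} (G : E n → ℝ → E n → (E n →L[ℝ] E n) → EReal)
    (D : Set (E n × ℝ)) (u : E n → ℝ → ℝ) : Prop :=
  ∀ φ : E n → ℝ → ℝ,
    (∀ t, ContDiff ℝ 2 fun x => φ x t) → (∀ x, ContDiff ℝ 1 (φ x)) →
    ∀ xhat that, (xhat, that) ∈ D →
    (∃ ε > (0:ℝ), ∀ x t, (x, t) ∈ D → ‖x - xhat‖ < ε → |t - that| < ε →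
        u x t - φ x t ≤ u xhat that - φ xhat that) →
    ((deriv (φ xhat) that : ℝ) : EReal) +
        G xhat that (gradient (fun x => φ x that) xhat) (hessian (fun x => φ x that) xhat) ≤ 0

/-- Standard parabolic viscosity supersolution condition. -/
def StdSupCond {n : ℕ} (G : E n → ℝ → E n → (E n →L[ℝ] E n) → EReal)
    (D : Set (E n × ℝ)) (u : E n → ℝ → ℝ) : Prop :=
  ∀ φ : E n → ℝ → ℝ,
    (∀ t, ContDiff ℝ 2 fun x => φ x t) → (∀ x, ContDiff ℝ 1 (φ x)) →
    ∀ xhat that, (xhat, that) ∈ D →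
    (∃ ε > (0:ℝ), ∀ x t, (x, t) ∈ D → ‖x - xhat‖ < ε → |t - that| < ε →
        u xhat that - φ xhat that ≤ u x t - φ x t) →
    0 ≤ ((deriv (φ xhat) that : ℝ) : EReal) +
        G xhat that (gradient (fun x => φ x that) xhat) (hessian (fun x => φ x that) xhat)

/-- The operator `H(x,t,p,X) := |p| g(p/|p|, -tr(∇²σ(p) X) + f(x,t))` of the level-set
equation (E), defined for `p ≠ 0`. -/
def levelSetH {n : ℕ} (σ : E n → ℝ) (g : E n → ℝ → ℝ) (f : E n → ℝ → ℝ)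
    (x : E n) (t : ℝ) (p : E n) (X : E n →L[ℝ] E n) : ℝ :=
  ‖p‖ * g (‖p‖⁻¹ • p) (-(trComp (hessian σ p) X) + f x t)

/-- Viscosity solution of the level-set equation (E) on `D`, via semicontinuous envelopes. -/
def IsViscSolnE {n : ℕ} (σ : E n → ℝ) (g : E n → ℝ → ℝ) (f : E n → ℝ → ℝ)
    (D : Set (E n × ℝ)) (u : E n → ℝ → ℝ) : Prop :=
  StdSubCond (fun x t => lowerEnvPX (levelSetH σ g f x t)) D u ∧
  StdSupCond (fun x t => upperEnvPX (levelSetH σ g f x t)) D u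

section ConvexAnalysis

variable {U : Type*} [NormedAddCommGroup U] [InnerProductSpace ℝ U]

/-- `P` selects a subgradient of `F` at every point; in particular `F` is convex. -/
def IsSubgradientSelection (F : U → ℝ) (P : U → U) : Prop :=
  ∀ z w, F z + ⟪P z, w - z⟫ ≤ F w

lemma IsSubgradientSelection.monotone {F : U → ℝ} {P : U → U}
    (hP : IsSubgradientSelection F P) (z w : U) : 0 ≤ ⟪P z - P w, z - w⟫ := by
  have h1 := hP z w
  have h2 := hP w z
  have h3 : ⟪P z, w - z⟫ = -⟪P z, z - w⟫ := by rw [← inner_neg_right, neg_sub]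
  rw [inner_sub_left]
  linarith

lemma IsSubgradientSelection.resolvent_nonexpansive {F : U → ℝ} {P : U → U}
    (hP : IsSubgradientSelection F P) (z w : U) :
    ‖z - w‖ ≤ ‖(z + P z) - (w + P w)‖ := by
  have h := hP.monotone z w
  have h1 : ⟪(z + P z) - (w + P w), z - w⟫ = ‖z - w‖ ^ 2 + ⟪P z - P w, z - w⟫ := by
    rw [← real_inner_self_eq_norm_sq, ← inner_add_left]; congr 1; abel
  have h2 := real_inner_le_norm ((z + P z) - (w + P w)) (z - w)
  by_cases h0 : ‖z - w‖ = 0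
  · rw [h0]; positivity
  · have : 0 < ‖z - w‖ := lt_of_le_of_ne (norm_nonneg _) (Ne.symm h0)
    nlinarith

/-- A subgradient at a point where `F` is touched from above by a smooth function is the gradient
of that function. -/
lemma IsSubgradientSelection.eq_of_contact {F : U → ℝ} {P : U → U}
    (hP : IsSubgradientSelection F P) {z p : U} {C ρ : ℝ} (hρ : 0 < ρ)
    (hc : ∀ h, ‖h‖ ≤ ρ → F (z + h) ≤ F z + ⟪p, h⟫ + C * ‖h‖ ^ 2) : P z = p := by
  by_contra hne
  set d := P z - p with hd
  have hd0 : 0 < ‖d‖ := norm_pos_iff.mpr (sub_ne_zero.mpr hne)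
  have key : ∀ t : ℝ, 0 < t → t * ‖d‖ ≤ ρ → 1 ≤ C * t := by
    intro t ht htρ
    have hn : ‖t • d‖ = t * ‖d‖ := by rw [norm_smul, Real.norm_of_nonneg ht.le]
    have h1 := hc (t • d) (by rw [hn]; exact htρ)
    have h2 := hP z (z + t • d)
    rw [add_sub_cancel_left] at h2
    have h3 : ⟪P z, t • d⟫ - ⟪p, t • d⟫ = t * ‖d‖ ^ 2 := by
      rw [← inner_sub_left, ← hd, real_inner_smul_right, real_inner_self_eq_norm_sq]
    rw [hn] at h1
    have h4 : t * ‖d‖ ^ 2 * 1 ≤ t * ‖d‖ ^ 2 * (C * t) := by nlinarith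
    exact le_of_mul_le_mul_left h4 (by positivity)
  have h1 := key (min (ρ / ‖d‖) (1 / (2 * (|C| + 1)))) (by positivity) (by
    calc _ ≤ (ρ / ‖d‖) * ‖d‖ := by gcongr; exact min_le_left _ _
      _ = ρ := by field_simp)
  have h2 : C * min (ρ / ‖d‖) (1 / (2 * (|C| + 1))) ≤ |C| * (1 / (2 * (|C| + 1))) := by
    gcongr
    · exact le_abs_self C
    · exact min_le_right _ _
  have h3 : |C| * (1 / (2 * (|C| + 1))) < 1 := by
    rw [mul_one_div, div_lt_one (by positivity)]
    linarith [abs_nonneg C]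
  linarith

lemma IsSubgradientSelection.norm_sub_le_of_contact {F : U → ℝ} {P : U → U}
    (hP : IsSubgradientSelection F P) {z p : U} {C ρ : ℝ} (hC : 0 ≤ C) (hρ : 0 < ρ)
    (hc : ∀ h, ‖h‖ ≤ ρ → F (z + h) ≤ F z + ⟪p, h⟫ + C * ‖h‖ ^ 2)
    {h : U} (hh : ‖h‖ ≤ ρ / 2) : ‖P (z + h) - p‖ ≤ 4 * C * ‖h‖ := by
  have hpz := hP.eq_of_contact hρ hc
  set d := P (z + h) - p with hd
  by_cases hd0 : d = 0
  · rw [hd0, norm_zero]; positivity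
  have hd0' : 0 < ‖d‖ := norm_pos_iff.mpr hd0
  by_cases hh0 : h = 0
  · simp [hd, hh0, hpz]
  have hh0' : 0 < ‖h‖ := norm_pos_iff.mpr hh0
  set e : U := (‖h‖ / ‖d‖) • d with he
  have hne : ‖e‖ = ‖h‖ := by
    rw [he, norm_smul, Real.norm_of_nonneg (by positivity)]; field_simp
  have hk : ‖h + e‖ ≤ 2 * ‖h‖ := by linarith [norm_add_le h e]
  have h1 := hc (h + e) (by linarith)
  have h2 := hP (z + h) (z + (h + e))
  have h3 := hP z (z + h)
  have e1 : z + (h + e) - (z + h) = e := by abel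
  rw [e1] at h2
  rw [add_sub_cancel_left, hpz] at h3
  have h4 : ⟪P (z + h), e⟫ - ⟪p, e⟫ = ‖h‖ * ‖d‖ := by
    rw [← inner_sub_left, ← hd, he, real_inner_smul_right, real_inner_self_eq_norm_sq]
    field_simp
  rw [inner_add_right] at h1
  have h5 : C * ‖h + e‖ ^ 2 ≤ C * (2 * ‖h‖) ^ 2 := by gcongr
  have h6 : ‖h‖ * ‖d‖ ≤ ‖h‖ * (4 * C * ‖h‖) := by nlinarith
  exact le_of_mul_le_mul_left h6 hh0'

/-- A convex function whose subgradients are differentiable at `z` has a second order expansion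
at `z`. -/
lemma IsSubgradientSelection.second_order_expansion {F : U → ℝ} {P : U → U}
    (hP : IsSubgradientSelection F P) {z : U} {A : U →L[ℝ] U} (hA : HasFDerivAt P A z)
    {η : ℝ} (hη : 0 < η) :
    ∃ r > 0, ∀ h, ‖h‖ ≤ r → |F (z + h) - F z - ⟪P z, h⟫ - 1 / 2 * ⟪A h, h⟫| ≤ η * ‖h‖ ^ 2 := by
  rw [hasFDerivAt_iff_isLittleO_nhds_zero, Asymptotics.isLittleO_iff] at hA
  obtain ⟨r, hr, hr'⟩ := Metric.eventually_nhds_iff.mp (hA hη)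
  refine ⟨r / 2, by positivity, fun h hh => ?_⟩
  have hbd : ∀ t : ℝ, 0 ≤ t → t ≤ 1 →
      |⟪P (z + t • h), h⟫ - ⟪P z, h⟫ - t * ⟪A h, h⟫| ≤ η * ‖h‖ ^ 2 := by
    intro t ht0 ht1
    have hn : ‖t • h‖ ≤ ‖h‖ := by
      rw [norm_smul, Real.norm_of_nonneg ht0]
      exact mul_le_of_le_one_left (norm_nonneg _) ht1
    have h1 := hr' (y := t • h) (by rw [dist_zero_right]; linarith)
    have h2 : ⟪P (z + t • h), h⟫ - ⟪P z, h⟫ - t * ⟪A h, h⟫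
        = ⟪P (z + t • h) - P z - A (t • h), h⟫ := by
      rw [inner_sub_left, inner_sub_left, map_smul, real_inner_smul_left]
    rw [h2]
    calc _ ≤ ‖P (z + t • h) - P z - A (t • h)‖ * ‖h‖ := abs_real_inner_le_norm _ _
      _ ≤ η * ‖h‖ * ‖h‖ := by gcongr; exact h1.trans (by gcongr)
      _ = η * ‖h‖ ^ 2 := by ring
  set a := ⟪A h, h⟫ with ha
  set b := ⟪P z, h⟫ with hb
  set E := η * ‖h‖ ^ 2 with hE
  have step : ∀ s t : ℝ, 0 ≤ s → s ≤ t → t ≤ 1 →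
      F (z + t • h) - F (z + s • h) ≤ (t - s) * (b + t * a + E) ∧
      (t - s) * (b + s * a - E) ≤ F (z + t • h) - F (z + s • h) := by
    intro s t hs hst ht
    have h1 := hP (z + t • h) (z + s • h)
    have h2 := hP (z + s • h) (z + t • h)
    have e1 : z + s • h - (z + t • h) = (s - t) • h := by rw [sub_smul]; abel
    have e2 : z + t • h - (z + s • h) = (t - s) • h := by rw [sub_smul]; abel
    rw [e1, real_inner_smul_right] at h1
    rw [e2, real_inner_smul_right] at h2
    have b1 := (abs_le.mp (hbd t (hs.trans hst) ht))
    have b2 := (abs_le.mp (hbd s hs (hst.trans ht)))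
    constructor <;> nlinarith
  have main : ∀ N : ℕ, 0 < N → ∀ i : ℕ, i ≤ N →
      F (z + ((i : ℝ) / N) • h) - F z ≤
        (i / N : ℝ) * b + (i * (i + 1) / (2 * N ^ 2) : ℝ) * a + (i / N : ℝ) * E ∧
      (i / N : ℝ) * b + (i * (i - 1) / (2 * N ^ 2) : ℝ) * a - (i / N : ℝ) * E ≤
        F (z + ((i : ℝ) / N) • h) - F z := by
    intro N hN i
    have hN' : (0 : ℝ) < N := by exact_mod_cast hN
    induction i with
    | zero => intro _; simp
    | succ i ih =>
      intro hi
      have hi' : ((i : ℝ) + 1) ≤ N := by exact_mod_cast hi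
      obtain ⟨u1, l1⟩ := ih (by omega)
      obtain ⟨u2, l2⟩ := step (i / N) ((i + 1) / N) (by positivity) (by gcongr; linarith)
        ((div_le_one hN').mpr hi')
      push_cast
      have e : ((i : ℝ) + 1) / N - i / N = 1 / N := by field_simp; ring
      rw [e] at u2 l2
      constructor
      · calc _ ≤ 1 / N * (b + ((i : ℝ) + 1) / N * a + E) + ((i / N : ℝ) * b
              + (i * (i + 1) / (2 * N ^ 2) : ℝ) * a + (i / N : ℝ) * E) := by linarith
          _ = _ := by field_simp; ring
      · calc _ = 1 / N * (b + (i : ℝ) / N * a - E) + ((i / N : ℝ) * b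
              + (i * (i - 1) / (2 * N ^ 2) : ℝ) * a - (i / N : ℝ) * E) := by field_simp; ring
          _ ≤ _ := by linarith
  have lim : Tendsto (fun N : ℕ => 1 / ((N : ℝ) + 1)) atTop (𝓝 0) :=
    tendsto_one_div_add_atTop_nhds_zero_nat
  have fin : ∀ N : ℕ, F (z + h) - F z ≤ b + (1 / 2) * (1 + 1 / ((N : ℝ) + 1)) * a + E ∧
      b + (1 / 2) * (1 - 1 / ((N : ℝ) + 1)) * a - E ≤ F (z + h) - F z := by
    intro N
    obtain ⟨h1, h2⟩ := main (N + 1) (by omega) (N + 1) le_rfl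
    have hN : ((N : ℝ) + 1) ≠ 0 := by positivity
    push_cast at h1 h2
    rw [div_self hN, one_smul] at h1 h2
    constructor
    · refine h1.trans (le_of_eq ?_); field_simp
    · refine le_trans (le_of_eq ?_) h2; field_simp
  rw [abs_le]
  constructor
  · have := le_of_tendsto (((((lim.const_sub 1).const_mul (1 / 2)).mul_const a).const_add b).sub_const E)
      (Eventually.of_forall fun N => (fin N).2)
    linarith
  · have := ge_of_tendsto (((((lim.const_add 1).const_mul (1 / 2)).mul_const a).const_add b).add_const E)
      (Eventually.of_forall fun N => (fin N).1)
    linarith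

end ConvexAnalysis

section JensenAlexandrov

variable {U : Type*} [NormedAddCommGroup U] [InnerProductSpace ℝ U]

lemma inner_symm_quadratic_add {B : U →L[ℝ] U} (hB : ∀ x y, ⟪B x, y⟫ = ⟪x, B y⟫) (h k : U) :
    ⟪B (h + k), h + k⟫ = ⟪B h, h⟫ + 2 * ⟪B h, k⟫ + ⟪B k, k⟫ := by
  have : ⟪B k, h⟫ = ⟪B h, k⟫ := by rw [hB k h, real_inner_comm]
  rw [map_add, inner_add_left, inner_add_right, inner_add_right, this]; ring

/-- Tilting by a small linear functional moves the contact point only slightly. -/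
lemma exists_contact_of_small_tilt [FiniteDimensional ℝ U] {F : U → ℝ} (hF : Continuous F)
    {z₀ p : U} {B : U →L[ℝ] U} (hB : ∀ x y, ⟪B x, y⟫ = ⟪x, B y⟫) {ρ κ : ℝ} (hκ : 0 < κ)
    (hc : ∀ h, ‖h‖ ≤ ρ → F (z₀ + h) ≤ F z₀ + ⟪p, h⟫ + 1 / 2 * ⟪B h, h⟫)
    (q : U) (hq : 2 * ‖q‖ / κ ≤ ρ / 2) :
    ∃ h, ‖h‖ ≤ 2 * ‖q‖ / κ ∧ ∀ k, ‖k‖ ≤ ρ / 2 →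
      F (z₀ + h + k) ≤ F (z₀ + h) + ⟪p + B h + κ • h + q, k⟫
        + (1 / 2 * ⟪B k, k⟫ + κ / 2 * ‖k‖ ^ 2) := by
  have hρ : 0 ≤ ρ := by have : 0 ≤ 2 * ‖q‖ / κ := by positivity
                        linarith
  obtain ⟨h, hh, hmax⟩ := (isCompact_closedBall (0 : U) ρ).exists_isMaxOn
    ⟨0, by simpa using hρ⟩
    (f := fun h => F (z₀ + h) - ⟪p, h⟫ - 1 / 2 * ⟪B h, h⟫ - κ / 2 * ‖h‖ ^ 2 - ⟪q, h⟫)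
    (by fun_prop)
  rw [mem_closedBall_zero_iff] at hh
  have hle : ‖h‖ ≤ 2 * ‖q‖ / κ := by
    have h0 := hmax (a := 0) (by simpa using hρ)
    simp only [mem_ofPred_eq, add_zero, inner_zero_right, norm_zero] at h0
    have h1 := hc h hh
    have h2 : -⟪q, h⟫ ≤ ‖q‖ * ‖h‖ := by
      rw [← inner_neg_left]; simpa using real_inner_le_norm (-q) h
    have h3 : κ / 2 * ‖h‖ ^ 2 ≤ ‖q‖ * ‖h‖ := by
      simp at h0; linarith
    rw [le_div_iff₀ hκ]
    by_cases hz : ‖h‖ = 0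
    · rw [hz]; simp
    · have : 0 < ‖h‖ := lt_of_le_of_ne (norm_nonneg _) (Ne.symm hz)
      nlinarith
  refine ⟨h, hle, fun k hk => ?_⟩
  have h1 := hmax (a := h + k) (by
    rw [mem_closedBall_zero_iff]; linarith [norm_add_le h k])
  simp only [mem_ofPred_eq] at h1
  rw [inner_symm_quadratic_add hB, norm_add_sq_real, inner_add_right, inner_add_right,
    ← add_assoc] at h1
  rw [inner_add_left, inner_add_left, inner_add_left, real_inner_smul_left]
  linarith

lemma measure_image_eq_zero_of_lipschitz [FiniteDimensional ℝ U] [MeasurableSpace U]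
    [BorelSpace U] {K : ℝ≥0} {T : U → U} (hT : LipschitzWith K T) {s : Set U}
    (hs : Measure.hausdorffMeasure (X := U) (Module.finrank ℝ U) s = 0) :
    Measure.hausdorffMeasure (X := U) (Module.finrank ℝ U) (T '' s) = 0 := by
  have := hT.hausdorffMeasure_image_le (d := Module.finrank ℝ U) (by positivity) s
  rw [hs, mul_zero] at this
  exact le_antisymm this zero_le

/-- If `J` is a Lipschitz left inverse of `w ↦ w + P w`, then `P` is differentiable at `z`
as soon as `J` has an invertible derivative at `z + P z` and `P` is continuous at `z`. -/
lemma hasFDerivAt_of_resolvent [FiniteDimensional ℝ U] {P J : U → U} {z : U}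
    (hJ : ∀ w, J (w + P w) = w) (hP : ContinuousAt P z)
    (hd : DifferentiableAt ℝ J (z + P z)) (hdet : (fderiv ℝ J (z + P z)).det ≠ 0) :
    ∃ A : U →L[ℝ] U, HasFDerivAt P A z := by
  have h1 : HasFDerivAt J
      (((fderiv ℝ J (z + P z)).toContinuousLinearEquivOfDetNeZero hdet : U ≃L[ℝ] U) : U →L[ℝ] U)
      (z + P z) := by
    rw [ContinuousLinearMap.coe_toContinuousLinearEquivOfDetNeZero]
    exact hd.hasFDerivAt
  have h2 := HasFDerivAt.of_local_left_inverse (g := fun w => w + P w) (a := z)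
    (continuousAt_id.add hP) h1 (Eventually.of_forall hJ)
  have h3 := h2.sub (hasFDerivAt_id z)
  exact ⟨_, h3.congr_of_eventuallyEq (Eventually.of_forall fun w => by simp)⟩

/-- Jensen's lemma combined with Alexandrov's theorem: if a convex function is touched from above
at `z₀` by a quadratic function, then arbitrarily close to `z₀` there are points at which its
subgradient is differentiable, close to the gradient of the quadratic function, and with
derivative almost bounded by its Hessian. -/
lemma IsSubgradientSelection.exists_hasFDerivAt_near_contact [FiniteDimensional ℝ U]
    {F : U → ℝ} {P : U → U} (hP : IsSubgradientSelection F P) (hF : Continuous F)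
    {z₀ p : U} {B : U →L[ℝ] U} (hB : ∀ x y, ⟪B x, y⟫ = ⟪x, B y⟫) {ρ : ℝ} (hρ : 0 < ρ)
    (hc : ∀ h, ‖h‖ ≤ ρ → F (z₀ + h) ≤ F z₀ + ⟪p, h⟫ + 1 / 2 * ⟪B h, h⟫)
    {κ : ℝ} (hκ : 0 < κ) :
    ∃ (z : U) (A : U →L[ℝ] U), ‖z - z₀‖ < κ ∧ ‖P z - p‖ < κ ∧ HasFDerivAt P A z ∧
      ∀ h, ⟪A h, h⟫ ≤ ⟪B h, h⟫ + κ * ‖h‖ ^ 2 := by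
  let _ : MeasurableSpace U := borel U
  have : BorelSpace U := ⟨rfl⟩
  set μ : Measure U := Measure.hausdorffMeasure (Module.finrank ℝ U) with hμ
  -- contact points
  set κ' : ℝ := κ / 2 with hκ'
  have hκ'0 : 0 < κ' := by positivity
  set C : ℝ := 1 / 2 * ‖B‖ + κ' / 2 with hC
  have hC0 : 0 ≤ C := by positivity
  set K : Set U := {z | ‖z - z₀‖ ≤ ρ / 16 ∧ ∃ p', ∀ k, ‖k‖ ≤ ρ / 2 →
    F (z + k) ≤ F z + ⟪p', k⟫ + (1 / 2 * ⟪B k, k⟫ + κ' / 2 * ‖k‖ ^ 2)} with hK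
  have hquad : ∀ k, 1 / 2 * ⟪B k, k⟫ + κ' / 2 * ‖k‖ ^ 2 ≤ C * ‖k‖ ^ 2 := by
    intro k
    have h1 : ⟪B k, k⟫ ≤ ‖B‖ * ‖k‖ * ‖k‖ :=
      (real_inner_le_norm _ _).trans (by gcongr; exact B.le_opNorm k)
    rw [hC]; nlinarith
  have hcontact : ∀ z ∈ K, (∀ k, ‖k‖ ≤ ρ / 2 →
      F (z + k) ≤ F z + ⟪P z, k⟫ + (1 / 2 * ⟪B k, k⟫ + κ' / 2 * ‖k‖ ^ 2)) := by
    rintro z ⟨-, p', hp'⟩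
    have : P z = p' := hP.eq_of_contact (C := C) (ρ := ρ / 2) (by positivity)
      fun h hh => (hp' h hh).trans (by linarith [hquad h])
    rwa [this]
  have hlip : ∀ z ∈ K, ∀ h, ‖h‖ ≤ ρ / 4 → ‖P (z + h) - P z‖ ≤ 4 * C * ‖h‖ := by
    intro z hz h hh
    exact hP.norm_sub_le_of_contact hC0 (ρ := ρ / 2) (by positivity)
      (fun h hh => (hcontact z hz h hh).trans (by linarith [hquad h])) (by linarith)
  have hlipK : LipschitzOnWith (4 * C).toNNReal P K := by
    refine LipschitzOnWith.of_dist_le_mul fun x hx y hy => ?_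
    rw [Real.coe_toNNReal _ (by positivity), dist_eq_norm, dist_eq_norm]
    have := hlip y hy (x - y) (by
      have e : x - y = (x - z₀) - (y - z₀) := by abel
      rw [e]; linarith [norm_sub_le (x - z₀) (y - z₀), hx.1, hy.1])
    simpa using this
  obtain ⟨Q, hQlip, hQ⟩ := hlipK.extend_finite_dimension
  -- the resolvent
  obtain ⟨J, hJlip, hJ⟩ : ∃ J : U → U, LipschitzWith (lipschitzExtensionConstant U * 1) J ∧
      ∀ w, J (w + P w) = w := by
    have hinj : Function.Injective fun w => w + P w := by
      intro x y hxy
      have := hP.resolvent_nonexpansive x y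
      simp only at hxy
      rw [hxy, sub_self, norm_zero] at this
      exact sub_eq_zero.mp (norm_le_zero_iff.mp this)
    have hinv := Function.leftInverse_invFun hinj
    have h1 : LipschitzOnWith 1 (Function.invFun fun w => w + P w) (range fun w => w + P w) := by
      refine LipschitzOnWith.of_dist_le_mul ?_
      rintro _ ⟨x, rfl⟩ _ ⟨y, rfl⟩
      rw [hinv x, hinv y, dist_eq_norm, dist_eq_norm]
      simpa using hP.resolvent_nonexpansive x y
    obtain ⟨J, h2, h3⟩ := h1.extend_finite_dimension
    exact ⟨J, h2, fun w => (h3 (mem_range_self w)).symm.trans (hinv w)⟩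
  -- the exceptional sets
  set N : Set U := {s | ¬ DifferentiableAt ℝ J s} with hN
  set S : Set U := {s | DifferentiableAt ℝ J s ∧ (fderiv ℝ J s).det = 0} with hS
  have hJN : μ (J '' N) = 0 :=
    measure_image_eq_zero_of_lipschitz hJlip hJlip.ae_differentiableAt
  have hJS : μ (J '' S) = 0 :=
    addHaar_image_eq_zero_of_det_fderivWithin_eq_zero μ (f' := fun s => fderiv ℝ J s)
      (fun x hx => hx.1.hasFDerivAt.hasFDerivWithinAt) fun x hx => hx.2
  set Θ : U → U := fun z => Q z - p - B (z - z₀) - κ' • (z - z₀) with hΘ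
  obtain ⟨M, hΘlip⟩ : ∃ M, LipschitzWith M Θ := by
    refine ⟨_, ((hQlip.sub (LipschitzWith.const p)).sub
      (B.lipschitz.comp (LipschitzWith.id.sub (LipschitzWith.const z₀)))).sub
      ((lipschitzWith_smul κ').comp (LipschitzWith.id.sub (LipschitzWith.const z₀)))⟩
  have hbad : μ (Θ '' (J '' N ∪ J '' S)) = 0 :=
    measure_image_eq_zero_of_lipschitz hΘlip (measure_union_null hJN hJS)
  -- radius of admissible tilts
  set D : ℝ := 1 + 2 / κ' + ‖B‖ * (2 / κ') + 2 with hD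
  have hD0 : 0 < D := by positivity
  set r : ℝ := min (ρ / 32) (κ / 2) / D with hr
  have hr0 : 0 < r := by positivity
  have hrD : r * D = min (ρ / 32) (κ / 2) := by rw [hr]; field_simp
  obtain ⟨q, hqr, hqbad⟩ : ∃ q ∈ ball (0 : U) r, q ∉ Θ '' (J '' N ∪ J '' S) := by
    by_contra! hcon
    have h1 : μ (ball (0 : U) r) ≤ 0 := hbad ▸ measure_mono hcon
    exact absurd h1 (not_le.mpr (measure_ball_pos μ _ hr0))
  rw [mem_ball_zero_iff] at hqr
  have hbd : ‖q‖ * D ≤ min (ρ / 32) (κ / 2) := by rw [← hrD]; gcongr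
  have hqn := norm_nonneg q
  have hbd1 : ‖q‖ * D ≤ ρ / 32 := hbd.trans (min_le_left _ _)
  have hbd2 : ‖q‖ * D ≤ κ / 2 := hbd.trans (min_le_right _ _)
  have e0 : 2 * ‖q‖ / κ' = ‖q‖ * (2 / κ') := by ring
  have hDge : ‖q‖ * (2 / κ') ≤ ‖q‖ * D := by
    gcongr; rw [hD]
    have : 0 ≤ ‖B‖ * (2 / κ') := by positivity
    linarith
  obtain ⟨h, hh, hcon⟩ := exists_contact_of_small_tilt hF hB hκ'0 hc q (by rw [e0]; linarith)
  rw [e0] at hh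
  set z := z₀ + h with hz
  have hzz : z - z₀ = h := by rw [hz]; abel
  have hzK : z ∈ K := ⟨by rw [hzz]; linarith, _, hcon⟩
  have hPz : P z = p + B h + κ' • h + q :=
    hP.eq_of_contact (C := C) (ρ := ρ / 2) (by positivity)
      fun h hh => (hcon h hh).trans (by linarith [hquad h])
  have hΘz : Θ z = q := by
    simp only [hΘ]
    rw [← hQ hzK, hPz, hzz]; abel
  have hz1 : z + P z ∉ N := fun hmem =>
    hqbad ⟨z, Or.inl ⟨_, hmem, hJ z⟩, hΘz⟩
  have hz2 : z + P z ∉ S := fun hmem =>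
    hqbad ⟨z, Or.inr ⟨_, hmem, hJ z⟩, hΘz⟩
  have hdiff : DifferentiableAt ℝ J (z + P z) := not_not.mp hz1
  have hdet : (fderiv ℝ J (z + P z)).det ≠ 0 := fun h0 => hz2 ⟨hdiff, h0⟩
  have hcont : ContinuousAt P z := by
    refine Metric.continuousAt_iff.mpr fun ε hε => ?_
    refine ⟨min (ρ / 4) (ε / (4 * C + 1)), by positivity, fun w hw => ?_⟩
    rw [dist_eq_norm] at hw ⊢
    have h1 := hlip z hzK (w - z) (hw.le.trans (min_le_left _ _))
    rw [add_sub_cancel] at h1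
    have h2 : ‖w - z‖ < ε / (4 * C + 1) := hw.trans_le (min_le_right _ _)
    rw [lt_div_iff₀ (by positivity)] at h2
    nlinarith [norm_nonneg (w - z)]
  obtain ⟨A, hA⟩ := hasFDerivAt_of_resolvent hJ hcont hdiff hdet
  refine ⟨z, A, ?_, ?_, hA, fun k => ?_⟩
  · rw [hzz]; linarith
  · have e1 : P z - p = B h + κ' • h + q := by rw [hPz]; abel
    have h1 : ‖B h‖ ≤ ‖B‖ * (‖q‖ * (2 / κ')) := (B.le_opNorm h).trans (by gcongr)
    have h2 : ‖κ' • h‖ ≤ 2 * ‖q‖ := by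
      rw [norm_smul, Real.norm_of_nonneg hκ'0.le]
      calc _ ≤ κ' * (‖q‖ * (2 / κ')) := by gcongr
        _ = _ := by field_simp
    rw [e1]
    have h3 : ‖q‖ * D = ‖q‖ + ‖q‖ * (2 / κ') + ‖B‖ * (‖q‖ * (2 / κ')) + 2 * ‖q‖ := by
      rw [hD]; ring
    have h4 : 0 ≤ ‖q‖ * (2 / κ') := by positivity
    have h5 := norm_add_le (B h + κ' • h) q
    have h6 := norm_add_le (B h) (κ' • h)
    linarith
  · -- compare the second order expansion with the contact inequality
    by_cases hk0 : k = 0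
    · simp [hk0]
    have hk : 0 < ‖k‖ := norm_pos_iff.mpr hk0
    obtain ⟨r', hr'0, hr'⟩ := hP.second_order_expansion hA (η := κ / 4) (by positivity)
    set t : ℝ := min (ρ / 2) r' / ‖k‖ with ht
    have ht0 : 0 < t := by positivity
    have hn : ‖t • k‖ = min (ρ / 2) r' := by
      rw [norm_smul, Real.norm_of_nonneg ht0.le, ht]; field_simp
    have h1 := hcontact z hzK (t • k) (hn.le.trans (min_le_left _ _))
    have h2 := (abs_le.mp (hr' (t • k) (hn.le.trans (min_le_right _ _)))).1
    have h3 : ‖t • k‖ = t * ‖k‖ := by rw [norm_smul, Real.norm_of_nonneg ht0.le]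
    rw [h3] at h1 h2
    simp only [map_smul, real_inner_smul_left, real_inner_smul_right] at h1 h2
    have h4 : t ^ 2 * ⟪A k, k⟫ ≤ t ^ 2 * (⟪B k, k⟫ + κ * ‖k‖ ^ 2) := by
      rw [hκ'] at h1
      nlinarith
    exact le_of_mul_le_mul_left h4 (by positivity)

end JensenAlexandrov

section TheoremOnSums

variable {V : Type*} [NormedAddCommGroup V] [InnerProductSpace ℝ V]

lemma IsSubgradientSelection.continuous [FiniteDimensional ℝ V] {F : V → ℝ} {P : V → V}
    (hP : IsSubgradientSelection F P) : Continuous F := by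
  have hconv : ConvexOn ℝ univ F := by
    refine ⟨convex_univ, fun x _ y _ s t hs ht hst => ?_⟩
    set z := s • x + t • y
    have h1 := hP z x
    have h2 := hP z y
    have h3 : s * ⟪P z, x - z⟫ + t * ⟪P z, y - z⟫ = 0 := by
      rw [← real_inner_smul_right, ← real_inner_smul_right, ← inner_add_right]
      have : s • (x - z) + t • (y - z) = 0 := by
        have e : s • (x - z) + t • (y - z) = z - (s + t) • z := by
          simp only [z, smul_sub, add_smul]; abel
        rw [e, hst, one_smul, sub_self]
      rw [this, inner_zero_right]
    have h4 : F z = s * F z + t * F z := by rw [← add_mul, hst, one_mul]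
    simp only [smul_eq_mul]
    nlinarith
  exact hconv.locallyLipschitz.continuous

lemma IsSubgradientSelection.inner_deriv_nonneg {F : V → ℝ} {P : V → V}
    (hP : IsSubgradientSelection F P) {z : V} {A : V →L[ℝ] V} (hA : HasFDerivAt P A z) (h : V) :
    0 ≤ ⟪A h, h⟫ := by
  by_cases hh : h = 0
  · simp [hh]
  have hh0 : 0 < ‖h‖ := norm_pos_iff.mpr hh
  refine le_of_forall_pos_le_add fun ε hε => ?_
  obtain ⟨r, hr, hexp⟩ := hP.second_order_expansion hA
    (η := ε / (2 * ‖h‖ ^ 2)) (by positivity)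
  set t : ℝ := r / ‖h‖
  have ht : 0 < t := by positivity
  have hn : ‖t • h‖ = t * ‖h‖ := by rw [norm_smul, Real.norm_of_nonneg ht.le]
  have h1 := (abs_le.mp (hexp (t • h) (by rw [hn]; simp only [t]; field_simp; rfl))).2
  have h2 := hP z (z + t • h)
  rw [add_sub_cancel_left] at h2
  rw [hn, map_smul] at h1
  simp only [real_inner_smul_left, real_inner_smul_right] at h1 h2
  have e : ε / (2 * ‖h‖ ^ 2) * (t * ‖h‖) ^ 2 = t ^ 2 * (ε / 2) := by field_simp
  rw [e] at h1
  have h3 : t ^ 2 * 0 ≤ t ^ 2 * (⟪A h, h⟫ + ε) := by nlinarith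
  exact le_of_mul_le_mul_left h3 (by positivity)

lemma norm_le_of_abs_inner_le {S : V →L[ℝ] V} (hS : ∀ x y, ⟪S x, y⟫ = ⟪x, S y⟫) {c : ℝ}
    (hc : 0 ≤ c) (h : ∀ x, |⟪S x, x⟫| ≤ c * ‖x‖ ^ 2) : ‖S‖ ≤ c := by
  refine S.opNorm_le_bound hc fun x => ?_
  by_cases hx : S x = 0
  · rw [hx, norm_zero]; positivity
  have hx0 : 0 < ‖S x‖ := norm_pos_iff.mpr hx
  have hx1 : 0 < ‖x‖ := norm_pos_iff.mpr fun h0 => hx (by rw [h0, map_zero])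
  set y : V := (‖x‖ / ‖S x‖) • S x with hy
  have hyn : ‖y‖ = ‖x‖ := by
    rw [hy, norm_smul, Real.norm_of_nonneg (by positivity)]; field_simp
  have hxy : ⟪S x, y⟫ = ‖x‖ * ‖S x‖ := by
    rw [hy, real_inner_smul_right, real_inner_self_eq_norm_sq]; field_simp
  have h1 := (abs_le.mp (h (x + y))).2
  have h2 := (abs_le.mp (h (x - y))).1
  have h3 := inner_symm_quadratic_add hS x y
  have h4 := inner_symm_quadratic_add hS x (-y)
  rw [← sub_eq_add_neg] at h4
  simp only [inner_neg_right, map_neg, inner_neg_left, neg_neg] at h4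
  have h5 := parallelogram_law_with_norm ℝ x y
  have h6 : 4 * ⟪S x, y⟫ ≤ c * (‖x + y‖ ^ 2 + ‖x - y‖ ^ 2) := by linarith
  have h7 : ‖x + y‖ ^ 2 + ‖x - y‖ ^ 2 = 4 * ‖x‖ ^ 2 := by rw [hyn] at h5; nlinarith
  rw [h7, hxy] at h6
  have h8 : ‖x‖ * ‖S x‖ ≤ ‖x‖ * (c * ‖x‖) := by nlinarith
  exact le_of_mul_le_mul_left h8 hx1

/-- `P z` realizes the sup-convolution `sup_{w ∈ Ω} (a w - ‖w - z‖² / 2)`. -/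
def IsProxSelection (a : V → ℝ) (Ω : Set V) (P : V → V) : Prop :=
  ∀ z, P z ∈ Ω ∧ ∀ w ∈ Ω, a w - 1 / 2 * ‖w - z‖ ^ 2 ≤ a (P z) - 1 / 2 * ‖P z - z‖ ^ 2

/-- The sup-convolution realized by `P`. -/
def proxValue (a : V → ℝ) (P : V → V) (z : V) : ℝ := a (P z) - 1 / 2 * ‖P z - z‖ ^ 2

lemma IsProxSelection.isSubgradientSelection {a : V → ℝ} {Ω : Set V} {P : V → V}
    (hP : IsProxSelection a Ω P) :
    IsSubgradientSelection (fun z => proxValue a P z + 1 / 2 * ‖z‖ ^ 2) P := by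
  intro z w
  have h := (hP w).2 (P z) (hP z).1
  simp only [proxValue]
  have h1 := norm_sub_sq_real (P z) z
  have h2 := norm_sub_sq_real (P z) w
  rw [inner_sub_right]
  linarith

/-- `(p, S)` is a second order superjet of `a`, relative to `Ω`, at `w`, realized by a
quadratic function. -/
def IsSuperjet (a : V → ℝ) (Ω : Set V) (w p : V) (S : V →L[ℝ] V) : Prop :=
  (∀ x y, ⟪S x, y⟫ = ⟪x, S y⟫) ∧
  ∃ r > 0, ∀ h, ‖h‖ ≤ r → w + h ∈ Ω → a (w + h) ≤ a w + ⟪p, h⟫ + 1 / 2 * ⟪S h, h⟫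

/-- Symmetric part of `A`, shifted by a multiple of the identity. -/
def shiftedSymm [FiniteDimensional ℝ V] (A : V →L[ℝ] V) (c : ℝ) : V →L[ℝ] V :=
  (1 / 2 : ℝ) • (A + ContinuousLinearMap.adjoint A) + c • ContinuousLinearMap.id ℝ V

lemma shiftedSymm_symm [FiniteDimensional ℝ V] (A : V →L[ℝ] V) (c : ℝ) (x y : V) :
    ⟪shiftedSymm A c x, y⟫ = ⟪x, shiftedSymm A c y⟫ := by
  simp only [shiftedSymm, add_apply, smul_apply,
    ContinuousLinearMap.id_apply, inner_add_left, inner_add_right, real_inner_smul_left,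
    real_inner_smul_right, ContinuousLinearMap.adjoint_inner_left,
    ContinuousLinearMap.adjoint_inner_right]
  ring

lemma inner_shiftedSymm [FiniteDimensional ℝ V] (A : V →L[ℝ] V) (c : ℝ) (x : V) :
    ⟪shiftedSymm A c x, x⟫ = ⟪A x, x⟫ + c * ‖x‖ ^ 2 := by
  simp only [shiftedSymm, add_apply, smul_apply,
    ContinuousLinearMap.id_apply, inner_add_left, real_inner_smul_left,
    ContinuousLinearMap.adjoint_inner_left, real_inner_self_eq_norm_sq]
  rw [real_inner_comm (A x) x]
  ring

lemma IsProxSelection.isSuperjet [FiniteDimensional ℝ V] {a : V → ℝ} {Ω : Set V} {P : V → V}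
    (hP : IsProxSelection a Ω P) {z : V} {A : V →L[ℝ] V} (hA : HasFDerivAt P A z) {η : ℝ}
    (hη : 0 < η) : IsSuperjet a Ω (P z) (P z - z) (shiftedSymm A (-1 + 2 * η)) := by
  refine ⟨shiftedSymm_symm A _, ?_⟩
  obtain ⟨r, hr, hexp⟩ := hP.isSubgradientSelection.second_order_expansion hA hη
  refine ⟨r, hr, fun h hh hΩ => ?_⟩
  have h1 := (abs_le.mp (hexp h hh)).2
  have h2 := (hP (z + h)).2 _ hΩ
  simp only [proxValue] at h1
  rw [add_sub_add_right_eq_sub] at h2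
  have h3 := norm_add_sq_real z h
  rw [inner_shiftedSymm, inner_sub_left]
  linarith

open WithLp in
/-- Theorem on sums for sup-convolutions, with a penalization whose Hessian is controlled by
`‖h₁‖² + ‖h₂‖² - 2 ⟪π h₁, h₂⟫`. -/
theorem theorem_on_sums [FiniteDimensional ℝ V] {a b : V → ℝ} {Ω : Set V} {P₁ P₂ : V → V}
    (hP₁ : IsProxSelection a Ω P₁) (hP₂ : IsProxSelection b Ω P₂) {z₁ z₂ g₁ g₂ : V}
    {π : V →L[ℝ] V} (hπ : ∀ x y, ⟪π x, y⟫ = ⟪x, π y⟫) {C ρ : ℝ} (hC : 0 ≤ C) (hρ : 0 < ρ)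
    (hc : ∀ h₁ h₂, ‖h₁‖ ≤ ρ → ‖h₂‖ ≤ ρ →
      proxValue a P₁ (z₁ + h₁) + proxValue b P₂ (z₂ + h₂) ≤ proxValue a P₁ z₁ + proxValue b P₂ z₂
        + ⟪g₁, h₁⟫ + ⟪g₂, h₂⟫ + C * (‖h₁‖ ^ 2 + ‖h₂‖ ^ 2 - 2 * ⟪π h₁, h₂⟫)) :
    P₁ z₁ - z₁ = g₁ ∧ P₂ z₂ - z₂ = g₂ ∧
    ∃ S₁ S₂ : V →L[ℝ] V,
      (P₁ z₁, g₁, S₁) ∈ closure {q : V × V × (V →L[ℝ] V) | IsSuperjet a Ω q.1 q.2.1 q.2.2} ∧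
      (P₂ z₂, g₂, S₂) ∈ closure {q : V × V × (V →L[ℝ] V) | IsSuperjet b Ω q.1 q.2.1 q.2.2} ∧
      ∀ h₁ h₂, ⟪S₁ h₁, h₁⟫ + ⟪S₂ h₂, h₂⟫ ≤ 2 * C * (‖h₁‖ ^ 2 + ‖h₂‖ ^ 2 - 2 * ⟪π h₁, h₂⟫) := by
  set F : WithLp 2 (V × V) → ℝ := fun z =>
    (proxValue a P₁ z.fst + 1 / 2 * ‖z.fst‖ ^ 2) + (proxValue b P₂ z.snd + 1 / 2 * ‖z.snd‖ ^ 2)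
    with hF
  set P : WithLp 2 (V × V) → WithLp 2 (V × V) := fun z => toLp 2 (P₁ z.fst, P₂ z.snd) with hPdef
  have hP : IsSubgradientSelection F P := by
    intro z w
    have h1 := hP₁.isSubgradientSelection z.fst w.fst
    have h2 := hP₂.isSubgradientSelection z.snd w.snd
    simp only [hF, hPdef, prod_inner_apply, ofLp_fst, ofLp_snd, sub_fst, sub_snd]
    linarith
  set B : WithLp 2 (V × V) →L[ℝ] WithLp 2 (V × V) :=
    ContinuousLinearMap.id ℝ _ + (2 * C) •
      ((prodContinuousLinearEquiv 2 ℝ V V).symm : V × V →L[ℝ] WithLp 2 (V × V)).comp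
        ((fstL 2 ℝ V V - π.comp (sndL 2 ℝ V V)).prod (sndL 2 ℝ V V - π.comp (fstL 2 ℝ V V)))
    with hBdef
  have hBinner : ∀ x y, ⟪B x, y⟫ = ⟪x.fst, y.fst⟫ + ⟪x.snd, y.snd⟫
      + 2 * C * (⟪x.fst - π x.snd, y.fst⟫ + ⟪x.snd - π x.fst, y.snd⟫) := by
    intro x y
    simp [hBdef, prod_inner_apply, inner_add_left, real_inner_smul_left]
    ring
  have hB : ∀ x y, ⟪B x, y⟫ = ⟪x, B y⟫ := by
    intro x y
    have e : ⟪x, B y⟫ = ⟪B y, x⟫ := real_inner_comm _ _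
    rw [e, hBinner, hBinner]
    simp only [inner_sub_left]
    rw [real_inner_comm x.fst y.fst, real_inner_comm x.snd y.snd, hπ x.snd y.fst,
      hπ x.fst y.snd, real_inner_comm (π y.fst) x.snd, real_inner_comm (π y.snd) x.fst]
    ring
  have hBquad : ∀ h, ⟪B h, h⟫ = ‖h‖ ^ 2
      + 2 * C * (‖h.fst‖ ^ 2 + ‖h.snd‖ ^ 2 - 2 * ⟪π h.fst, h.snd⟫) := by
    intro h
    rw [hBinner, prod_norm_sq_eq_of_L2]
    simp only [inner_sub_left, real_inner_self_eq_norm_sq]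
    rw [hπ h.snd h.fst, real_inner_comm (π h.fst) h.snd]
    ring
  set z₀ : WithLp 2 (V × V) := toLp 2 (z₁, z₂) with hz₀
  set p : WithLp 2 (V × V) := toLp 2 (z₁ + g₁, z₂ + g₂) with hp
  have hcF : ∀ h, ‖h‖ ≤ ρ → F (z₀ + h) ≤ F z₀ + ⟪p, h⟫ + 1 / 2 * ⟪B h, h⟫ := by
    intro h hh
    have h1 := hc h.fst h.snd ((norm_fst_le _ h).trans hh) ((norm_snd_le _ h).trans hh)
    rw [hBquad, prod_norm_sq_eq_of_L2]
    simp only [hF, hz₀, hp, prod_inner_apply, ofLp_fst, ofLp_snd, add_fst, add_snd, toLp_fst,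
      toLp_snd, inner_add_left, norm_add_sq_real]
    linarith
  have hPz₀ : P z₀ = p := by
    refine hP.eq_of_contact (C := 1 / 2 * ‖B‖) hρ fun h hh => (hcF h hh).trans ?_
    have h1 : ⟪B h, h⟫ ≤ ‖B‖ * ‖h‖ * ‖h‖ :=
      (real_inner_le_norm _ _).trans (by gcongr; exact B.le_opNorm h)
    nlinarith
  have hP1z : P₁ z₁ = z₁ + g₁ := congrArg WithLp.fst hPz₀
  have hP2z : P₂ z₂ = z₂ + g₂ := congrArg WithLp.snd hPz₀
  refine ⟨by rw [hP1z]; abel, by rw [hP2z]; abel, ?_⟩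
  set κ : ℕ → ℝ := fun k => 1 / ((k : ℝ) + 1) with hκ
  have hκ0 : ∀ k, 0 < κ k := fun k => by positivity
  have hκ1 : ∀ k, κ k ≤ 1 := fun k => by
    simp only [hκ]; rw [div_le_one (by positivity)]; linarith [Nat.cast_nonneg (α := ℝ) k]
  have hκlim : Tendsto κ atTop (𝓝 0) := tendsto_one_div_add_atTop_nhds_zero_nat
  choose Z A hZ hPZ hAder hAle using fun k =>
    hP.exists_hasFDerivAt_near_contact hP.continuous hB hρ hcF (hκ0 k)
  have hZlim : Tendsto Z atTop (𝓝 z₀) := by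
    rw [tendsto_iff_norm_sub_tendsto_zero]
    exact squeeze_zero (fun _ => norm_nonneg _) (fun k => (hZ k).le) hκlim
  have hPZlim : Tendsto (fun k => P (Z k)) atTop (𝓝 p) := by
    rw [tendsto_iff_norm_sub_tendsto_zero]
    exact squeeze_zero (fun _ => norm_nonneg _) (fun k => (hPZ k).le) hκlim
  -- the derivative of `P` is block diagonal
  set ι₁ : V →L[ℝ] WithLp 2 (V × V) :=
    ((prodContinuousLinearEquiv 2 ℝ V V).symm : V × V →L[ℝ] WithLp 2 (V × V)).comp
      (ContinuousLinearMap.inl ℝ V V) with hι₁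
  set ι₂ : V →L[ℝ] WithLp 2 (V × V) :=
    ((prodContinuousLinearEquiv 2 ℝ V V).symm : V × V →L[ℝ] WithLp 2 (V × V)).comp
      (ContinuousLinearMap.inr ℝ V V) with hι₂
  set A₁ : ℕ → V →L[ℝ] V := fun k => (fstL 2 ℝ V V).comp ((A k).comp ι₁) with hA₁
  set A₂ : ℕ → V →L[ℝ] V := fun k => (sndL 2 ℝ V V).comp ((A k).comp ι₂) with hA₂
  have hder₁ : ∀ k, HasFDerivAt P₁ (A₁ k) (Z k).fst := by
    intro k
    have h1 : HasFDerivAt (fun v => Z k + ι₁ (v - (Z k).fst)) ι₁ (Z k).fst :=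
      ((ι₁.hasFDerivAt).comp _ ((hasFDerivAt_id _).sub_const _)).const_add _
    have h2 : HasFDerivAt P (A k) (Z k + ι₁ ((Z k).fst - (Z k).fst)) := by
      simpa using hAder k
    have h3 := (fstL 2 ℝ V V).hasFDerivAt.comp (Z k).fst
      (HasFDerivAt.comp (g := P) (f := fun v => Z k + ι₁ (v - (Z k).fst)) (Z k).fst h2 h1)
    refine h3.congr_of_eventuallyEq (Eventually.of_forall fun v => ?_)
    simp [hPdef, hι₁]
  have hder₂ : ∀ k, HasFDerivAt P₂ (A₂ k) (Z k).snd := by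
    intro k
    have h1 : HasFDerivAt (fun v => Z k + ι₂ (v - (Z k).snd)) ι₂ (Z k).snd :=
      ((ι₂.hasFDerivAt).comp _ ((hasFDerivAt_id _).sub_const _)).const_add _
    have h2 : HasFDerivAt P (A k) (Z k + ι₂ ((Z k).snd - (Z k).snd)) := by
      simpa using hAder k
    have h3 := (sndL 2 ℝ V V).hasFDerivAt.comp (Z k).snd
      (HasFDerivAt.comp (g := P) (f := fun v => Z k + ι₂ (v - (Z k).snd)) (Z k).snd h2 h1)
    refine h3.congr_of_eventuallyEq (Eventually.of_forall fun v => ?_)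
    simp [hPdef, hι₂]
  have hblock₁ : ∀ k h, (A k h).fst = A₁ k h.fst := by
    intro k h
    have h1 : HasFDerivAt (fun z => (P z).fst) ((fstL 2 ℝ V V).comp (A k)) (Z k) :=
      (fstL 2 ℝ V V).hasFDerivAt.comp _ (hAder k)
    have h2 : HasFDerivAt (fun z : WithLp 2 (V × V) => P₁ z.fst)
        ((A₁ k).comp (fstL 2 ℝ V V)) (Z k) :=
      (hder₁ k).comp (Z k) (fstL 2 ℝ V V).hasFDerivAt
    exact congrArg (fun T => T h) (h1.unique h2)
  have hblock₂ : ∀ k h, (A k h).snd = A₂ k h.snd := by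
    intro k h
    have h1 : HasFDerivAt (fun z => (P z).snd) ((sndL 2 ℝ V V).comp (A k)) (Z k) :=
      (sndL 2 ℝ V V).hasFDerivAt.comp _ (hAder k)
    have h2 : HasFDerivAt (fun z : WithLp 2 (V × V) => P₂ z.snd)
        ((A₂ k).comp (sndL 2 ℝ V V)) (Z k) :=
      (hder₂ k).comp (Z k) (sndL 2 ℝ V V).hasFDerivAt
    exact congrArg (fun T => T h) (h1.unique h2)
  have hsum : ∀ k h₁ h₂, ⟪A₁ k h₁, h₁⟫ + ⟪A₂ k h₂, h₂⟫ ≤ (1 + κ k) * (‖h₁‖ ^ 2 + ‖h₂‖ ^ 2)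
      + 2 * C * (‖h₁‖ ^ 2 + ‖h₂‖ ^ 2 - 2 * ⟪π h₁, h₂⟫) := by
    intro k h₁ h₂
    have h1 := hAle k (toLp 2 (h₁, h₂))
    rw [hBquad, prod_inner_apply, ofLp_fst, ofLp_snd, hblock₁, hblock₂,
      prod_norm_sq_eq_of_L2] at h1
    simp only [toLp_fst, toLp_snd] at h1
    linarith
  set T₁ : ℕ → V →L[ℝ] V := fun k => shiftedSymm (A₁ k) (-1 + 2 * κ k)
  set T₂ : ℕ → V →L[ℝ] V := fun k => shiftedSymm (A₂ k) (-1 + 2 * κ k)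
  have hT₁ : ∀ k, ‖T₁ k‖ ≤ 2 * C + 3 := fun k => by
    refine norm_le_of_abs_inner_le (shiftedSymm_symm _ _) (by positivity) fun x => ?_
    have h1 := hsum k x 0
    have h2 := hP₁.isSubgradientSelection.inner_deriv_nonneg (hder₁ k) x
    simp only [map_zero, inner_zero_right, norm_zero] at h1
    rw [inner_shiftedSymm, abs_le]
    have := hκ1 k
    have := hκ0 k
    constructor <;> nlinarith [sq_nonneg ‖x‖]
  have hT₂ : ∀ k, ‖T₂ k‖ ≤ 2 * C + 3 := fun k => by
    refine norm_le_of_abs_inner_le (shiftedSymm_symm _ _) (by positivity) fun x => ?_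
    have h1 := hsum k 0 x
    have h2 := hP₂.isSubgradientSelection.inner_deriv_nonneg (hder₂ k) x
    simp only [map_zero, inner_zero_left, norm_zero] at h1
    rw [inner_shiftedSymm, abs_le]
    have := hκ1 k
    have := hκ0 k
    constructor <;> nlinarith [sq_nonneg ‖x‖]
  obtain ⟨⟨S₁, S₂⟩, -, φ, hφ, hlim⟩ := ((isCompact_closedBall (0 : V →L[ℝ] V) (2 * C + 3)).prod
    (isCompact_closedBall (0 : V →L[ℝ] V) (2 * C + 3))).tendsto_subseq
    (x := fun k => (T₁ k, T₂ k)) fun k =>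
      ⟨by simpa using hT₁ k, by simpa using hT₂ k⟩
  have hl₁ : Tendsto (fun k => T₁ (φ k)) atTop (𝓝 S₁) := (continuous_fst.tendsto _).comp hlim
  have hl₂ : Tendsto (fun k => T₂ (φ k)) atTop (𝓝 S₂) := (continuous_snd.tendsto _).comp hlim
  have hZφ := hZlim.comp hφ.tendsto_atTop
  have hPφ := hPZlim.comp hφ.tendsto_atTop
  have c1 := (fstL 2 ℝ V V).continuous
  have c2 := (sndL 2 ℝ V V).continuous
  refine ⟨S₁, S₂, ?_, ?_, fun h₁ h₂ => ?_⟩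
  · have l1 : Tendsto (fun k => P₁ (Z (φ k)).fst) atTop (𝓝 (P₁ z₁)) := by
      rw [hP1z]; exact (c1.tendsto p).comp hPφ
    have l2 : Tendsto (fun k => (Z (φ k)).fst) atTop (𝓝 z₁) := (c1.tendsto z₀).comp hZφ
    have e : P₁ z₁ - z₁ = g₁ := by rw [hP1z]; abel
    have l3 := l1.sub l2
    rw [e] at l3
    exact mem_closure_of_tendsto (l1.prodMk_nhds (l3.prodMk_nhds hl₁))
      (Eventually.of_forall fun k => hP₁.isSuperjet (hder₁ _) (hκ0 _))
  · have l1 : Tendsto (fun k => P₂ (Z (φ k)).snd) atTop (𝓝 (P₂ z₂)) := by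
      rw [hP2z]; exact (c2.tendsto p).comp hPφ
    have l2 : Tendsto (fun k => (Z (φ k)).snd) atTop (𝓝 z₂) := (c2.tendsto z₀).comp hZφ
    have e : P₂ z₂ - z₂ = g₂ := by rw [hP2z]; abel
    have l3 := l1.sub l2
    rw [e] at l3
    exact mem_closure_of_tendsto (l1.prodMk_nhds (l3.prodMk_nhds hl₂))
      (Eventually.of_forall fun k => hP₂.isSuperjet (hder₂ _) (hκ0 _))
  · have l1 : Tendsto (fun k => ⟪T₁ (φ k) h₁, h₁⟫ + ⟪T₂ (φ k) h₂, h₂⟫) atTop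
        (𝓝 (⟪S₁ h₁, h₁⟫ + ⟪S₂ h₂, h₂⟫)) :=
      ((((ContinuousLinearMap.apply ℝ V h₁).continuous.tendsto S₁).comp hl₁).inner
          tendsto_const_nhds).add
        ((((ContinuousLinearMap.apply ℝ V h₂).continuous.tendsto S₂).comp hl₂).inner
          tendsto_const_nhds)
    have l2 := (((hκlim.comp hφ.tendsto_atTop).const_mul 3).mul_const
      (‖h₁‖ ^ 2 + ‖h₂‖ ^ 2)).const_add (2 * C * (‖h₁‖ ^ 2 + ‖h₂‖ ^ 2 - 2 * ⟪π h₁, h₂⟫))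
    rw [mul_zero, zero_mul, add_zero] at l2
    refine le_of_tendsto_of_tendsto' l1 l2 fun k => ?_
    have := hsum (φ k) h₁ h₂
    simp only [T₁, T₂, inner_shiftedSymm, Function.comp_apply]
    linarith

end TheoremOnSums

section LevelSetOperator

variable {n : ℕ}

lemma lowerEnvPX_eq_of_continuousAt {H : E n → (E n →L[ℝ] E n) → ℝ} {p : E n}
    {X : E n →L[ℝ] E n} (hp : p ≠ 0)
    (hH : ContinuousAt (fun q : E n × (E n →L[ℝ] E n) => H q.1 q.2) (p, X)) :
    lowerEnvPX H p X = H p X := by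
  have ho : IsOpen {q : E n × (E n →L[ℝ] E n) | q.1 ≠ 0} :=
    isOpen_ne_fun continuous_fst continuous_const
  rw [lowerEnvPX, ho.nhdsWithin_eq (show (p, X) ∈ _ from hp)]
  exact (continuous_coe_real_ereal.continuousAt.comp hH).tendsto.liminf_eq

lemma upperEnvPX_eq_of_continuousAt {H : E n → (E n →L[ℝ] E n) → ℝ} {p : E n}
    {X : E n →L[ℝ] E n} (hp : p ≠ 0)
    (hH : ContinuousAt (fun q : E n × (E n →L[ℝ] E n) => H q.1 q.2) (p, X)) :
    upperEnvPX H p X = H p X := by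
  have ho : IsOpen {q : E n × (E n →L[ℝ] E n) | q.1 ≠ 0} :=
    isOpen_ne_fun continuous_fst continuous_const
  rw [upperEnvPX, ho.nhdsWithin_eq (show (p, X) ∈ _ from hp)]
  exact (continuous_coe_real_ereal.continuousAt.comp hH).tendsto.limsup_eq

lemma contDiffAt_gradient {σ : E n → ℝ} {p : E n} (hσ : ContDiffAt ℝ 2 σ p) :
    ContDiffAt ℝ 1 (gradient σ) p :=
  (InnerProductSpace.toDual ℝ (E n)).symm.toContinuousLinearEquiv.contDiff.contDiffAt.comp p
    (hσ.fderiv_right (m := 1) (by norm_num))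

lemma continuousAt_hessian {σ : E n → ℝ} {p : E n} (hσ : ContDiffAt ℝ 2 σ p) :
    ContinuousAt (hessian σ) p :=
  ((contDiffAt_gradient hσ).fderiv_right (m := 0) (by norm_num)).continuousAt

lemma continuous_trComp :
    Continuous fun q : (E n →L[ℝ] E n) × (E n →L[ℝ] E n) => trComp q.1 q.2 := by
  have h1 : Continuous fun A : E n →L[ℝ] E n => LinearMap.trace ℝ (E n) A.toLinearMap :=
    LinearMap.continuous_of_finiteDimensional
      ((LinearMap.trace ℝ (E n)).comp (ContinuousLinearMap.coeLM ℝ))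
  exact h1.comp (continuous_fst.clm_comp continuous_snd)

lemma continuousAt_levelSetH {T : ℝ} {σ : E n → ℝ} (hσC2 : ContDiffOn ℝ 2 σ {x : E n | x ≠ 0})
    {g : E n → ℝ → ℝ}
    (hgcont : ContinuousOn (fun q : E n × ℝ => g q.1 q.2) ({p : E n | ‖p‖ = 1} ×ˢ univ))
    {f : E n → ℝ → ℝ}
    (hfcont : ContinuousOn (fun q : E n × ℝ => f q.1 q.2) (univ ×ˢ Icc 0 T))
    {x : E n} {t : ℝ} (ht : t ∈ Ioo 0 T) {p : E n} (hp : p ≠ 0) (X : E n →L[ℝ] E n) :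
    ContinuousAt (fun q : (E n × ℝ) × E n × (E n →L[ℝ] E n) =>
      levelSetH σ g f q.1.1 q.1.2 q.2.1 q.2.2) ((x, t), p, X) := by
  have hp' : ContinuousAt (fun q : (E n × ℝ) × E n × (E n →L[ℝ] E n) => q.2.1) ((x, t), p, X) :=
    (continuous_fst.comp continuous_snd).continuousAt
  have hX' : ContinuousAt (fun q : (E n × ℝ) × E n × (E n →L[ℝ] E n) => q.2.2) ((x, t), p, X) :=
    (continuous_snd.comp continuous_snd).continuousAt
  have hf : ContinuousAt (fun q : (E n × ℝ) × E n × (E n →L[ℝ] E n) => f q.1.1 q.1.2)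
      ((x, t), p, X) := by
    have : ContinuousAt (fun q : E n × ℝ => f q.1 q.2) (x, t) :=
      hfcont.continuousAt (prod_mem_nhds univ_mem (Icc_mem_nhds ht.1 ht.2))
    exact ContinuousAt.comp (g := fun q : E n × ℝ => f q.1 q.2) this continuous_fst.continuousAt
  have hσ : ContinuousAt (fun q : (E n × ℝ) × E n × (E n →L[ℝ] E n) => hessian σ q.2.1)
      ((x, t), p, X) :=
    ContinuousAt.comp (g := hessian σ) (continuousAt_hessian
      (hσC2.contDiffAt (isOpen_ne.mem_nhds hp))) hp'
  have htr : ContinuousAt (fun q : (E n × ℝ) × E n × (E n →L[ℝ] E n) =>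
      trComp (hessian σ q.2.1) q.2.2) ((x, t), p, X) :=
    ContinuousAt.comp
      (g := fun q : (E n →L[ℝ] E n) × (E n →L[ℝ] E n) => trComp q.1 q.2)
      continuous_trComp.continuousAt (hσ.prodMk hX')
  have hdir : ContinuousAt (fun q : (E n × ℝ) × E n × (E n →L[ℝ] E n) => ‖q.2.1‖⁻¹ • q.2.1)
      ((x, t), p, X) := (hp'.norm.inv₀ (norm_ne_zero_iff.mpr hp)).smul hp'
  have hmaps : ∀ᶠ q : (E n × ℝ) × E n × (E n →L[ℝ] E n) in 𝓝 ((x, t), p, X),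
      (‖q.2.1‖⁻¹ • q.2.1, -(trComp (hessian σ q.2.1) q.2.2) + f q.1.1 q.1.2) ∈
        ({p : E n | ‖p‖ = 1} ×ˢ univ : Set (E n × ℝ)) := by
    filter_upwards [hp'.eventually_ne hp] with q hq
    exact ⟨by simp [norm_smul, norm_ne_zero_iff.mpr hq], mem_univ _⟩
  have hcomp : Tendsto (fun q : (E n × ℝ) × E n × (E n →L[ℝ] E n) =>
      (‖q.2.1‖⁻¹ • q.2.1, -(trComp (hessian σ q.2.1) q.2.2) + f q.1.1 q.1.2))
      (𝓝 ((x, t), p, X)) (𝓝[{p : E n | ‖p‖ = 1} ×ˢ univ]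
        (‖p‖⁻¹ • p, -(trComp (hessian σ p) X) + f x t)) :=
    tendsto_nhdsWithin_iff.mpr ⟨(hdir.prodMk (htr.neg.add hf)).tendsto, hmaps⟩
  exact hp'.norm.mul ((hgcont _ hmaps.self_of_nhds).tendsto.comp hcomp)

lemma trComp_le_trComp {A X Y : E n →L[ℝ] E n} (hA : ∀ v, 0 ≤ ⟪A v, v⟫)
    (hX : ∀ x y, ⟪X x, y⟫ = ⟪x, X y⟫) (hY : ∀ x y, ⟪Y x, y⟫ = ⟪x, Y y⟫)
    (hXY : ∀ v, ⟪X v, v⟫ ≤ ⟪Y v, v⟫) : trComp A X ≤ trComp A Y := by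
  have hD : ((Y - X : E n →L[ℝ] E n) : E n →ₗ[ℝ] E n).IsSymmetric := fun x y => by
    simp [inner_sub_left, inner_sub_right, hX, hY]
  have hn : Module.finrank ℝ (E n) = n := by simp
  set b := hD.eigenvectorBasis hn
  have hb : ∀ i, (Y - X) (b i) = hD.eigenvalues hn i • b i := hD.apply_eigenvectorBasis hn
  have hpos : ∀ i, 0 ≤ hD.eigenvalues hn i := fun i => by
    have h1 := hXY (b i)
    have h2 : ⟪(Y - X) (b i), b i⟫ = hD.eigenvalues hn i := by
      rw [hb, real_inner_smul_left, real_inner_self_eq_norm_sq, b.norm_eq_one]; ring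
    rw [← h2, sub_apply, inner_sub_left]
    linarith
  have hsub : trComp A Y - trComp A X = trComp A (Y - X) := by
    simp only [trComp, ContinuousLinearMap.comp_sub, ContinuousLinearMap.toLinearMap_sub, map_sub]
  have htr : trComp A (Y - X) = ∑ i, hD.eigenvalues hn i * ⟪A (b i), b i⟫ := by
    rw [trComp, LinearMap.trace_eq_sum_inner _ b]
    refine Finset.sum_congr rfl fun i _ => ?_
    have : (A.comp (Y - X)) (b i) = hD.eigenvalues hn i • A (b i) := by
      rw [ContinuousLinearMap.comp_apply, hb, map_smul]
    rw [ContinuousLinearMap.coe_coe, this, real_inner_smul_right, real_inner_comm]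
  have : 0 ≤ trComp A (Y - X) := by
    rw [htr]
    exact Finset.sum_nonneg fun i _ => mul_nonneg (hpos i) (hA _)
  linarith

lemma _root_.ConvexOn.add_inner_gradient_le {σ : E n → ℝ} (hσ : ConvexOn ℝ univ σ) {x : E n}
    (hx : DifferentiableAt ℝ σ x) (y : E n) : σ x + ⟪gradient σ x, y - x⟫ ≤ σ y := by
  have hconv : ConvexOn ℝ univ fun s : ℝ => σ (AffineMap.lineMap x y s) := by
    exact hσ.comp_affineMap (AffineMap.lineMap x y : ℝ →ᵃ[ℝ] E n)
  have hder : HasDerivAt (fun s : ℝ => σ (AffineMap.lineMap x y s)) ⟪gradient σ x, y - x⟫ 0 := by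
    have h1 : HasDerivAt (fun s : ℝ => (AffineMap.lineMap x y s : E n)) (y - x) 0 :=
      AffineMap.hasDerivAt_lineMap
    have h2 : HasFDerivAt σ (InnerProductSpace.toDual ℝ (E n) (gradient σ x))
        (AffineMap.lineMap x y (0 : ℝ)) := by
      simpa using hx.hasGradientAt.hasFDerivAt
    exact h2.comp_hasDerivAt 0 h1
  have := hconv.le_slope_of_hasDerivAt (mem_univ 0) (mem_univ 1) one_pos hder
  rw [slope_def_field, AffineMap.lineMap_apply_one, AffineMap.lineMap_apply_zero, sub_zero,
    div_one] at this
  linarith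

lemma _root_.ConvexOn.inner_hessian_nonneg {σ : E n → ℝ} (hσ : ConvexOn ℝ univ σ) {p : E n}
    (hp : ContDiffAt ℝ 2 σ p) (v : E n) : 0 ≤ ⟪hessian σ p v, v⟫ := by
  have hline : HasDerivAt (fun s : ℝ => p + s • v) v 0 := by
    simpa using ((hasDerivAt_id (0 : ℝ)).smul_const v).const_add p
  have hgrad : HasFDerivAt (gradient σ) (hessian σ p) (p + (0 : ℝ) • v) := by
    rw [zero_smul, add_zero]
    exact ((contDiffAt_gradient hp).differentiableAt (by norm_num)).hasFDerivAt
  have hder : HasDerivAt (fun s : ℝ => ⟪gradient σ (p + s • v), v⟫) ⟪hessian σ p v, v⟫ 0 := by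
    simpa using (hgrad.comp_hasDerivAt (0 : ℝ) hline).inner ℝ (hasDerivAt_const (0 : ℝ) v)
  have hdiff : ∀ᶠ s : ℝ in 𝓝 0, DifferentiableAt ℝ σ (p + s • v) := by
    have h1 : ∀ᶠ q in 𝓝 p, DifferentiableAt ℝ σ q := by
      filter_upwards [hp.eventually (by simp)] with q hq using hq.differentiableAt (by norm_num)
    have h2 : Tendsto (fun s : ℝ => p + s • v) (𝓝 0) (𝓝 p) := by
      simpa using hline.continuousAt.tendsto
    exact h2.eventually h1
  refine ge_of_tendsto hder.tendsto_slope ?_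
  filter_upwards [hdiff.filter_mono nhdsWithin_le_nhds, self_mem_nhdsWithin] with s hs hs0
  have h1 := hσ.add_inner_gradient_le (hp.differentiableAt (by norm_num)) (p + s • v)
  have h2 := hσ.add_inner_gradient_le hs p
  simp only [add_sub_cancel_left, sub_add_cancel_left, inner_neg_right,
    real_inner_smul_right] at h1 h2
  rw [slope_def_field, zero_smul, add_zero, sub_zero]
  have h3 : 0 ≤ s * (⟪gradient σ (p + s • v), v⟫ - ⟪gradient σ p, v⟫) := by linarith
  have h5 : (⟪gradient σ (p + s • v), v⟫ - ⟪gradient σ p, v⟫) / s =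
      s * (⟪gradient σ (p + s • v), v⟫ - ⟪gradient σ p, v⟫) / s ^ 2 := by
    have : s ≠ 0 := hs0
    field_simp
  rw [h5]
  positivity

end LevelSetOperator

section ParabolicJets

open WithLp

variable {n : ℕ}

/-- Space-time with its Euclidean structure. -/
abbrev SpaceTime (n : ℕ) := WithLp 2 (E n × ℝ)

/-- The closed time strip `ℝⁿ × [0, T]`. -/
def timeStrip (n : ℕ) (T : ℝ) : Set (SpaceTime n) := {w | w.snd ∈ Icc 0 T}

/-- The embedding of space into space-time at time zero. -/
def spaceIncl (n : ℕ) : E n →L[ℝ] SpaceTime n :=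
  ((prodContinuousLinearEquiv 2 ℝ (E n) ℝ).symm : E n × ℝ →L[ℝ] SpaceTime n).comp
    (ContinuousLinearMap.inl ℝ (E n) ℝ)

@[simp] lemma spaceIncl_apply (v : E n) : spaceIncl n v = toLp 2 (v, 0) := rfl

/-- The spatial diagonal block of an endomorphism of space-time. -/
def spatialBlock (S : SpaceTime n →L[ℝ] SpaceTime n) : E n →L[ℝ] E n :=
  (fstL 2 ℝ (E n) ℝ).comp (S.comp (spaceIncl n))

lemma inner_spatialBlock (S : SpaceTime n →L[ℝ] SpaceTime n) (v w : E n) :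
    ⟪spatialBlock S v, w⟫ = ⟪S (spaceIncl n v), spaceIncl n w⟫ := by
  simp [spatialBlock, prod_inner_apply]

lemma spatialBlock_smul (c : ℝ) (S : SpaceTime n →L[ℝ] SpaceTime n) :
    spatialBlock (c • S) = c • spatialBlock S := by
  ext v; simp [spatialBlock]

lemma continuous_spatialBlock : Continuous (spatialBlock (n := n)) :=
  continuous_const.clm_comp (continuous_id.clm_comp continuous_const)

/-- The quadratic function of space-time with gradient `p` and Hessian `S` at `w`. -/
def quadTest (w p : SpaceTime n) (S : SpaceTime n →L[ℝ] SpaceTime n) (x : E n) (t : ℝ) : ℝ :=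
  ⟪p, toLp 2 (x, t) - w⟫ + 1 / 2 * ⟪S (toLp 2 (x, t) - w), toLp 2 (x, t) - w⟫

lemma contDiff_quadTest_comp {F : Type*} [NormedAddCommGroup F] [NormedSpace ℝ F]
    (w p : SpaceTime n) (S : SpaceTime n →L[ℝ] SpaceTime n) {k : WithTop ℕ∞} {γ : F → SpaceTime n}
    (hγ : ContDiff ℝ k γ) :
    ContDiff ℝ k fun y => ⟪p, γ y - w⟫ + 1 / 2 * ⟪S (γ y - w), γ y - w⟫ :=
  have h := hγ.sub (contDiff_const (c := w))
  (contDiff_const.inner ℝ h).add (contDiff_const.mul ((S.contDiff.comp h).inner ℝ h))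

lemma contDiff_quadTest_space (w p : SpaceTime n) (S : SpaceTime n →L[ℝ] SpaceTime n) (t : ℝ) :
    ContDiff ℝ 2 fun x => quadTest w p S x t := by
  have h : ContDiff ℝ 2 fun x : E n => (toLp 2 (x, t) : SpaceTime n) :=
    (prodContinuousLinearEquiv 2 ℝ (E n) ℝ).symm.contDiff.comp (contDiff_id.prodMk contDiff_const)
  exact contDiff_quadTest_comp w p S h

lemma contDiff_quadTest_time (w p : SpaceTime n) (S : SpaceTime n →L[ℝ] SpaceTime n) (x : E n) :
    ContDiff ℝ 1 (quadTest w p S x) := by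
  have h : ContDiff ℝ 1 fun t : ℝ => (toLp 2 (x, t) : SpaceTime n) :=
    (prodContinuousLinearEquiv 2 ℝ (E n) ℝ).symm.contDiff.comp (contDiff_const.prodMk contDiff_id)
  exact contDiff_quadTest_comp w p S h

lemma quadTest_self (p : SpaceTime n) (S : SpaceTime n →L[ℝ] SpaceTime n) (w : SpaceTime n) :
    quadTest w p S w.fst w.snd = 0 := by
  have : toLp 2 (w.fst, w.snd) - w = 0 := sub_eq_zero.mpr rfl
  simp [quadTest, this]

lemma deriv_quadTest (w p : SpaceTime n) (S : SpaceTime n →L[ℝ] SpaceTime n) :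
    deriv (quadTest w p S w.fst) w.snd = p.snd := by
  have h1 : ∀ t : ℝ, (toLp 2 (w.fst, t) : SpaceTime n) - w = (t - w.snd) • toLp 2 (0, 1) := by
    intro t
    apply WithLp.ofLp_injective
    ext <;> simp
  have h2 : quadTest w p S w.fst = fun t => p.snd * (t - w.snd)
      + 1 / 2 * ⟪S (toLp 2 (0, 1)), toLp 2 (0, 1)⟫ * (t - w.snd) ^ 2 := by
    funext t
    simp only [quadTest, h1, map_smul, real_inner_smul_left, real_inner_smul_right]
    have : ⟪p, toLp 2 (0, 1)⟫ = p.snd := by simp [prod_inner_apply]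
    rw [this]
    ring
  rw [h2]
  have h3 := ((hasDerivAt_id w.snd).sub_const w.snd)
  have h4 := (h3.const_mul p.snd).add ((h3.pow 2).const_mul
    (1 / 2 * ⟪S (toLp 2 (0, 1)), toLp 2 (0, 1)⟫))
  refine HasDerivAt.deriv (HasDerivAt.congr_deriv h4 ?_)
  simp

lemma gradient_quadTest (w p : SpaceTime n) {S : SpaceTime n →L[ℝ] SpaceTime n}
    (hS : ∀ x y, ⟪S x, y⟫ = ⟪x, S y⟫) (x : E n) :
    gradient (fun x => quadTest w p S x w.snd) x = p.fst + spatialBlock S (x - w.fst) := by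
  have h1 : ∀ x : E n, (toLp 2 (x, w.snd) : SpaceTime n) - w = spaceIncl n (x - w.fst) := by
    intro x
    apply WithLp.ofLp_injective
    ext <;> simp
  have h2 : (fun x => quadTest w p S x w.snd) = fun x => ⟪p.fst, x - w.fst⟫
      + 1 / 2 * ⟪spatialBlock S (x - w.fst), x - w.fst⟫ := by
    funext x
    rw [quadTest, h1, inner_spatialBlock]
    simp [prod_inner_apply]
  have hsymm : ∀ x y, ⟪spatialBlock S x, y⟫ = ⟪x, spatialBlock S y⟫ := fun x y => by
    rw [inner_spatialBlock, hS, real_inner_comm, ← inner_spatialBlock, real_inner_comm]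
  rw [h2]
  refine HasGradientAt.gradient (hasGradientAt_iff_hasFDerivAt.mpr ?_)
  have h3 : HasFDerivAt (fun x => x - w.fst) (ContinuousLinearMap.id ℝ (E n)) x :=
    (hasFDerivAt_id x).sub_const _
  have h4 := (spatialBlock S).hasFDerivAt.comp x h3
  have h5 := ((hasFDerivAt_const p.fst x).inner ℝ h3).add
    ((h4.inner ℝ h3).const_mul (1 / 2 : ℝ))
  refine h5.congr_fderiv ?_
  ext v
  have e1 := hsymm (x - w.fst) v
  have e2 := real_inner_comm v (spatialBlock S (x - w.fst))
  have e3 := real_inner_comm (x - w.fst) (spatialBlock S v)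
  simp only [add_apply, smul_apply, ContinuousLinearMap.comp_apply, fderivInnerCLM_apply,
    ContinuousLinearMap.prod_apply, ContinuousLinearMap.id_apply, zero_apply, inner_zero_left,
    InnerProductSpace.toDual_apply_apply, Function.comp_apply, inner_add_left, smul_eq_mul]
  linarith

lemma hessian_quadTest (w p : SpaceTime n) {S : SpaceTime n →L[ℝ] SpaceTime n}
    (hS : ∀ x y, ⟪S x, y⟫ = ⟪x, S y⟫) (x : E n) :
    hessian (fun x => quadTest w p S x w.snd) x = spatialBlock S := by
  have h : gradient (fun x => quadTest w p S x w.snd) =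
      fun x => p.fst + spatialBlock S (x - w.fst) :=
    funext fun x => gradient_quadTest w p hS x
  rw [hessian, h]
  exact (((spatialBlock S).hasFDerivAt.comp x ((hasFDerivAt_id x).sub_const _)).const_add _).fderiv

lemma IsSuperjet.scaled_bound {T c : ℝ} {u : E n → ℝ → ℝ} {w p : SpaceTime n}
    {S : SpaceTime n →L[ℝ] SpaceTime n}
    (h : IsSuperjet (fun w => c * u w.fst w.snd) (timeStrip n T) w p S) :
    ∃ r > 0, ∀ x t, (x, t) ∈ (univ ×ˢ Ioo 0 T : Set (E n × ℝ)) → ‖x - w.fst‖ < r →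
      |t - w.snd| < r → c * u x t ≤ c * u w.fst w.snd + quadTest w p S x t := by
  obtain ⟨-, r, hr, h⟩ := h
  refine ⟨r / 2, by positivity, fun x t hxt hx ht => ?_⟩
  have h1 : w + (toLp 2 (x, t) - w) = toLp 2 (x, t) := by abel
  have h2 : ‖(toLp 2 (x, t) : SpaceTime n) - w‖ ≤ r := by
    refine abs_le_of_sq_le_sq' ?_ hr.le |>.2
    rw [prod_norm_sq_eq_of_L2]
    have e1 : ((toLp 2 (x, t) : SpaceTime n) - w).fst = x - w.fst := rfl
    have e2 : ((toLp 2 (x, t) : SpaceTime n) - w).snd = t - w.snd := rfl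
    rw [e1, e2, Real.norm_eq_abs]
    nlinarith [norm_nonneg (x - w.fst), abs_nonneg (t - w.snd)]
  have h3 := h _ h2 (by rw [h1]; exact Ioo_subset_Icc_self hxt.2)
  rw [h1] at h3
  simp only [toLp_fst, toLp_snd] at h3
  rw [quadTest]
  linarith

lemma quadTest_smul (c : ℝ) (w p : SpaceTime n) (S : SpaceTime n →L[ℝ] SpaceTime n) (x : E n)
    (t : ℝ) : quadTest w (c • p) (c • S) x t = c * quadTest w p S x t := by
  simp only [quadTest, real_inner_smul_left, smul_apply]
  ring

lemma StdSubCond.of_isSuperjet {G : E n → ℝ → E n → (E n →L[ℝ] E n) → EReal} {T c : ℝ}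
    {u : E n → ℝ → ℝ} (hu : StdSubCond G (univ ×ˢ Ioo 0 T) u) (hc : 0 < c)
    {w p : SpaceTime n} {S : SpaceTime n →L[ℝ] SpaceTime n} (hw : w.snd ∈ Ioo 0 T)
    (h : IsSuperjet (fun w => c * u w.fst w.snd) (timeStrip n T) w p S) :
    ((c⁻¹ * p.snd : ℝ) : EReal)
      + G w.fst w.snd (c⁻¹ • p.fst) (c⁻¹ • spatialBlock S) ≤ 0 := by
  obtain ⟨r, hr, hb⟩ := h.scaled_bound
  have hS : ∀ x y, ⟪(c⁻¹ • S) x, y⟫ = ⟪x, (c⁻¹ • S) y⟫ := fun x y => by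
    rw [smul_apply, smul_apply, real_inner_smul_left, real_inner_smul_right, h.1]
  have := hu (quadTest w (c⁻¹ • p) (c⁻¹ • S))
    (contDiff_quadTest_space w _ _)
    (contDiff_quadTest_time w _ _)
    w.fst w.snd ⟨mem_univ _, hw⟩ ⟨r, hr, fun x t hxt hx ht => ?_⟩
  · rw [deriv_quadTest, gradient_quadTest w _ hS, hessian_quadTest w _ hS, sub_self, map_zero,
      add_zero, spatialBlock_smul] at this
    exact this
  · rw [quadTest_self, quadTest_smul]
    have h1 := mul_le_mul_of_nonneg_left (hb x t hxt hx ht) (inv_pos.mpr hc).le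
    rw [mul_add, inv_mul_cancel_left₀ hc.ne', inv_mul_cancel_left₀ hc.ne'] at h1
    linarith

lemma StdSupCond.of_isSuperjet {G : E n → ℝ → E n → (E n →L[ℝ] E n) → EReal} {T c : ℝ}
    {u : E n → ℝ → ℝ} (hu : StdSupCond G (univ ×ˢ Ioo 0 T) u) (hc : c < 0)
    {w p : SpaceTime n} {S : SpaceTime n →L[ℝ] SpaceTime n} (hw : w.snd ∈ Ioo 0 T)
    (h : IsSuperjet (fun w => c * u w.fst w.snd) (timeStrip n T) w p S) :
    0 ≤ ((c⁻¹ * p.snd : ℝ) : EReal)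
      + G w.fst w.snd (c⁻¹ • p.fst) (c⁻¹ • spatialBlock S) := by
  obtain ⟨r, hr, hb⟩ := h.scaled_bound
  have hS : ∀ x y, ⟪(c⁻¹ • S) x, y⟫ = ⟪x, (c⁻¹ • S) y⟫ := fun x y => by
    rw [smul_apply, smul_apply, real_inner_smul_left, real_inner_smul_right, h.1]
  have := hu (quadTest w (c⁻¹ • p) (c⁻¹ • S))
    (contDiff_quadTest_space w _ _)
    (contDiff_quadTest_time w _ _)
    w.fst w.snd ⟨mem_univ _, hw⟩ ⟨r, hr, fun x t hxt hx ht => ?_⟩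
  · rw [deriv_quadTest, gradient_quadTest w _ hS, hessian_quadTest w _ hS, sub_self, map_zero,
      add_zero, spatialBlock_smul] at this
    exact this
  · rw [quadTest_self, quadTest_smul]
    have h1 := mul_le_mul_of_nonpos_left (hb x t hxt hx ht) (inv_lt_zero.mpr hc).le
    rw [mul_add, inv_mul_cancel_left₀ hc.ne, inv_mul_cancel_left₀ hc.ne] at h1
    linarith

/-- Symmetry of the second-order part passes to limits of superjets. -/
lemma symm_of_mem_closure_isSuperjet {V : Type*} [NormedAddCommGroup V] [InnerProductSpace ℝ V]
    {a : V → ℝ} {Ω : Set V} {w p : V} {S : V →L[ℝ] V}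
    (h : (w, p, S) ∈ closure {q : V × V × (V →L[ℝ] V) | IsSuperjet a Ω q.1 q.2.1 q.2.2})
    (x y : V) : ⟪S x, y⟫ = ⟪x, S y⟫ := by
  have hev : ∀ v : V, Continuous fun q : V × V × (V →L[ℝ] V) => q.2.2 v := fun v =>
    (ContinuousLinearMap.apply ℝ V v).continuous.comp (continuous_snd.comp continuous_snd)
  have hcl : IsClosed {q : V × V × (V →L[ℝ] V) | ⟪q.2.2 x, y⟫ = ⟪x, q.2.2 y⟫} :=
    isClosed_eq ((hev x).inner continuous_const) (continuous_const.inner (hev y))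
  exact closure_minimal (fun q hq => hq.1 x y) hcl h

lemma closure_le_of_continuousAt {X : Type*} [TopologicalSpace X] {s : Set X} {Φ : X → ℝ} {q : X}
    (hq : q ∈ closure s) (hΦ : ContinuousAt Φ q) (h : ∀ᶠ q' in 𝓝 q, q' ∈ s → Φ q' ≤ 0) :
    Φ q ≤ 0 := by
  by_contra! hpos
  obtain ⟨q', hq', hs, h1⟩ :=
    ((mem_closure_iff_frequently.mp hq).and_eventually (h.and (hΦ.eventually_const_lt hpos))).exists
  exact absurd (hs hq') (not_le.mpr h1)

/-- The time derivative plus the level-set operator along a rescaled second-order jet. -/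
def jetOperator (σ : E n → ℝ) (g f : E n → ℝ → ℝ) (c : ℝ)
    (q : SpaceTime n × SpaceTime n × (SpaceTime n →L[ℝ] SpaceTime n)) : ℝ :=
  c⁻¹ * q.2.1.snd + levelSetH σ g f q.1.fst q.1.snd (c⁻¹ • q.2.1.fst) (c⁻¹ • spatialBlock q.2.2)

lemma continuousAt_jetOperator {T : ℝ} {σ : E n → ℝ} (hσC2 : ContDiffOn ℝ 2 σ {x : E n | x ≠ 0})
    {g : E n → ℝ → ℝ}
    (hgcont : ContinuousOn (fun q : E n × ℝ => g q.1 q.2) ({p : E n | ‖p‖ = 1} ×ˢ univ))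
    {f : E n → ℝ → ℝ}
    (hfcont : ContinuousOn (fun q : E n × ℝ => f q.1 q.2) (univ ×ˢ Icc 0 T))
    {c : ℝ} (hc : c ≠ 0)
    {q : SpaceTime n × SpaceTime n × (SpaceTime n →L[ℝ] SpaceTime n)}
    (ht : q.1.snd ∈ Ioo 0 T) (hp : q.2.1.fst ≠ 0) :
    ContinuousAt (jetOperator σ g f c) q := by
  have c1 := (fstL 2 ℝ (E n) ℝ).continuous
  have c2 := (sndL 2 ℝ (E n) ℝ).continuous
  have cp : Continuous fun q : SpaceTime n × SpaceTime n × (SpaceTime n →L[ℝ] SpaceTime n) =>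
      q.2.1 := continuous_fst.comp continuous_snd
  have cS : Continuous fun q : SpaceTime n × SpaceTime n × (SpaceTime n →L[ℝ] SpaceTime n) =>
      q.2.2 := continuous_snd.comp continuous_snd
  refine ((c2.comp cp).const_mul _).continuousAt.add ?_
  have hΛ := continuousAt_levelSetH hσC2 hgcont hfcont ht (x := q.1.fst)
    (smul_ne_zero (inv_ne_zero hc) hp) (c⁻¹ • spatialBlock q.2.2)
  refine ContinuousAt.comp (f := fun q : SpaceTime n × SpaceTime n ×
      (SpaceTime n →L[ℝ] SpaceTime n) =>
      ((q.1.fst, q.1.snd), c⁻¹ • q.2.1.fst, c⁻¹ • spatialBlock q.2.2)) hΛ ?_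
  exact (((c1.comp continuous_fst).prodMk (c2.comp continuous_fst)).prodMk
    (((c1.comp cp).const_smul c⁻¹).prodMk
      ((continuous_spatialBlock.comp cS).const_smul c⁻¹))).continuousAt

lemma eventually_jet_regular {T : ℝ}
    {q : SpaceTime n × SpaceTime n × (SpaceTime n →L[ℝ] SpaceTime n)}
    (ht : q.1.snd ∈ Ioo 0 T) (hp : q.2.1.fst ≠ 0) :
    ∀ᶠ q' in 𝓝 q, q'.1.snd ∈ Ioo 0 T ∧ q'.2.1.fst ≠ 0 := by
  have c1 := (fstL 2 ℝ (E n) ℝ).continuous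
  have c2 := (sndL 2 ℝ (E n) ℝ).continuous
  have cp : Continuous fun q : SpaceTime n × SpaceTime n × (SpaceTime n →L[ℝ] SpaceTime n) =>
      q.2.1 := continuous_fst.comp continuous_snd
  exact ((c2.comp continuous_fst).continuousAt.eventually (isOpen_Ioo.mem_nhds ht)).and
    ((c1.comp cp).continuousAt.eventually_ne hp)

lemma continuousAt_levelSetH_jet {T : ℝ} {σ : E n → ℝ} (hσC2 : ContDiffOn ℝ 2 σ {x : E n | x ≠ 0})
    {g : E n → ℝ → ℝ}
    (hgcont : ContinuousOn (fun q : E n × ℝ => g q.1 q.2) ({p : E n | ‖p‖ = 1} ×ˢ univ))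
    {f : E n → ℝ → ℝ}
    (hfcont : ContinuousOn (fun q : E n × ℝ => f q.1 q.2) (univ ×ˢ Icc 0 T))
    {x : E n} {t : ℝ} (ht : t ∈ Ioo 0 T) {p : E n} (hp : p ≠ 0)
    (X : E n →L[ℝ] E n) :
    ContinuousAt (fun q : E n × (E n →L[ℝ] E n) => levelSetH σ g f x t q.1 q.2) (p, X) :=
  (continuousAt_levelSetH hσC2 hgcont hfcont ht hp X).comp (f := fun q => ((x, t), q))
    (continuous_const.prodMk continuous_id).continuousAt

lemma jetOperator_nonpos {T : ℝ} {σ : E n → ℝ} (hσC2 : ContDiffOn ℝ 2 σ {x : E n | x ≠ 0})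
    {g : E n → ℝ → ℝ}
    (hgcont : ContinuousOn (fun q : E n × ℝ => g q.1 q.2) ({p : E n | ‖p‖ = 1} ×ˢ univ))
    {f : E n → ℝ → ℝ}
    (hfcont : ContinuousOn (fun q : E n × ℝ => f q.1 q.2) (univ ×ˢ Icc 0 T))
    {c : ℝ} (hc : 0 < c) {u : E n → ℝ → ℝ}
    (hu : StdSubCond (fun x t => lowerEnvPX (levelSetH σ g f x t)) (univ ×ˢ Ioo 0 T) u)
    {q : SpaceTime n × SpaceTime n × (SpaceTime n →L[ℝ] SpaceTime n)}
    (ht : q.1.snd ∈ Ioo 0 T) (hp : q.2.1.fst ≠ 0)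
    (hq : q ∈ closure {q : SpaceTime n × SpaceTime n × (SpaceTime n →L[ℝ] SpaceTime n) |
      IsSuperjet (fun w => c * u w.fst w.snd) (timeStrip n T) q.1 q.2.1 q.2.2}) :
    jetOperator σ g f c q ≤ 0 := by
  refine closure_le_of_continuousAt hq
    (continuousAt_jetOperator hσC2 hgcont hfcont hc.ne' ht hp) ?_
  filter_upwards [eventually_jet_regular ht hp] with q' hq' hjet
  have h1 := hu.of_isSuperjet hc hq'.1 hjet
  have hp' := smul_ne_zero (inv_ne_zero hc.ne') hq'.2
  rw [lowerEnvPX_eq_of_continuousAt hp' (continuousAt_levelSetH_jet hσC2 hgcont hfcont hq'.1 hp' _)]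
    at h1
  exact_mod_cast h1

lemma jetOperator_nonneg {T : ℝ} {σ : E n → ℝ} (hσC2 : ContDiffOn ℝ 2 σ {x : E n | x ≠ 0})
    {g : E n → ℝ → ℝ}
    (hgcont : ContinuousOn (fun q : E n × ℝ => g q.1 q.2) ({p : E n | ‖p‖ = 1} ×ˢ univ))
    {f : E n → ℝ → ℝ}
    (hfcont : ContinuousOn (fun q : E n × ℝ => f q.1 q.2) (univ ×ˢ Icc 0 T))
    {c : ℝ} (hc : c < 0) {u : E n → ℝ → ℝ}
    (hu : StdSupCond (fun x t => upperEnvPX (levelSetH σ g f x t)) (univ ×ˢ Ioo 0 T) u)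
    {q : SpaceTime n × SpaceTime n × (SpaceTime n →L[ℝ] SpaceTime n)}
    (ht : q.1.snd ∈ Ioo 0 T) (hp : q.2.1.fst ≠ 0)
    (hq : q ∈ closure {q : SpaceTime n × SpaceTime n × (SpaceTime n →L[ℝ] SpaceTime n) |
      IsSuperjet (fun w => c * u w.fst w.snd) (timeStrip n T) q.1 q.2.1 q.2.2}) :
    0 ≤ jetOperator σ g f c q := by
  have := closure_le_of_continuousAt (Φ := fun q => -jetOperator σ g f c q) hq
    (continuousAt_jetOperator hσC2 hgcont hfcont hc.ne ht hp).neg ?_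
  · exact neg_nonpos.mp this
  filter_upwards [eventually_jet_regular ht hp] with q' hq' hjet
  have h1 := hu.of_isSuperjet hc hq'.1 hjet
  have hp' := smul_ne_zero (inv_ne_zero hc.ne) hq'.2
  rw [upperEnvPX_eq_of_continuousAt hp' (continuousAt_levelSetH_jet hσC2 hgcont hfcont hq'.1 hp' _)]
    at h1
  exact neg_nonpos.mpr (by exact_mod_cast h1)

end ParabolicJets

section DoublingVariables

open WithLp

variable {n : ℕ}

/-- The orthogonal projection of space-time onto space. -/
def spaceProj (n : ℕ) : SpaceTime n →L[ℝ] SpaceTime n := (spaceIncl n).comp (fstL 2 ℝ (E n) ℝ)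

lemma inner_spaceProj (z w : SpaceTime n) : ⟪spaceProj n z, w⟫ = ⟪z.fst, w.fst⟫ := by
  simp [spaceProj, prod_inner_apply]

lemma spaceProj_symm (z w : SpaceTime n) : ⟪spaceProj n z, w⟫ = ⟪z, spaceProj n w⟫ := by
  rw [inner_spaceProj, real_inner_comm, ← inner_spaceProj, real_inner_comm]

lemma norm_sq_add_sub_spaceProj (h₁ h₂ : SpaceTime n) :
    ‖h₁‖ ^ 2 + ‖h₂‖ ^ 2 - 2 * ⟪spaceProj n h₁, h₂⟫
      = ‖h₁.fst - h₂.fst‖ ^ 2 + h₁.snd ^ 2 + h₂.snd ^ 2 := by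
  rw [inner_spaceProj, prod_norm_sq_eq_of_L2, prod_norm_sq_eq_of_L2, norm_sub_sq_real,
    Real.norm_eq_abs, Real.norm_eq_abs, sq_abs, sq_abs]
  ring

/-- Comparison of the equations at the two points of a contact of the doubled problem. -/
lemma time_slope_sub_le {T : ℝ} {σ : E n → ℝ} (hσC2 : ContDiffOn ℝ 2 σ {x : E n | x ≠ 0})
    (hσconv : ConvexOn ℝ univ σ) {g : E n → ℝ → ℝ}
    (hgcont : ContinuousOn (fun q : E n × ℝ => g q.1 q.2) ({p : E n | ‖p‖ = 1} ×ˢ univ))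
    {Lg : ℝ} (hLg : ∀ p : E n, ‖p‖ = 1 → ∀ ξ₁ ξ₂, |g p ξ₁ - g p ξ₂| ≤ Lg * |ξ₁ - ξ₂|)
    (hgmono : ∀ p : E n, ‖p‖ = 1 → Monotone (g p)) {f : E n → ℝ → ℝ}
    (hfcont : ContinuousOn (fun q : E n × ℝ => f q.1 q.2) (univ ×ˢ Icc 0 T))
    {u : E n → ℝ → ℝ} (husol : IsViscSolnE σ g f (univ ×ˢ Ioo 0 T) u)
    {ε : ℝ} (hε : 0 < ε) {P₁ P₂ : SpaceTime n → SpaceTime n}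
    (hP₁ : IsProxSelection (fun w => ε * u w.fst w.snd) (timeStrip n T) P₁)
    (hP₂ : IsProxSelection (fun w => -ε * u w.fst w.snd) (timeStrip n T) P₂)
    {z₁ z₂ : SpaceTime n} {q : E n} (hq : q ≠ 0) {τ₁ τ₂ C ρ : ℝ} (hC : 0 ≤ C) (hρ : 0 < ρ)
    (ht₁ : (P₁ z₁).snd ∈ Ioo 0 T) (ht₂ : (P₂ z₂).snd ∈ Ioo 0 T)
    (hcontact : ∀ h₁ h₂, ‖h₁‖ ≤ ρ → ‖h₂‖ ≤ ρ →
      proxValue (fun w => ε * u w.fst w.snd) P₁ (z₁ + h₁)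
        + proxValue (fun w => -ε * u w.fst w.snd) P₂ (z₂ + h₂)
      ≤ proxValue (fun w => ε * u w.fst w.snd) P₁ z₁
        + proxValue (fun w => -ε * u w.fst w.snd) P₂ z₂
        + ε * (⟪q, h₁.fst - h₂.fst⟫ + τ₁ * h₁.snd - τ₂ * h₂.snd)
        + C * (‖h₁.fst - h₂.fst‖ ^ 2 + h₁.snd ^ 2 + h₂.snd ^ 2)) :
    τ₁ - τ₂ ≤ ‖q‖ * (Lg * |f (P₁ z₁).fst (P₁ z₁).snd - f (P₂ z₂).fst (P₂ z₂).snd|) := by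
  obtain ⟨-, -, S₁, S₂, hS₁, hS₂, hS⟩ := theorem_on_sums hP₁ hP₂ (z₁ := z₁) (z₂ := z₂)
    (g₁ := ε • toLp 2 (q, τ₁)) (g₂ := -ε • toLp 2 (q, τ₂)) spaceProj_symm hC hρ
    fun h₁ h₂ hh₁ hh₂ => by
      have h := hcontact h₁ h₂ hh₁ hh₂
      rw [norm_sq_add_sub_spaceProj]
      have e₁ : ⟪ε • toLp 2 (q, τ₁), h₁⟫ = ε * (⟪q, h₁.fst⟫ + τ₁ * h₁.snd) := by
        rw [real_inner_smul_left, prod_inner_apply]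
        simp [mul_comm]
      have e₂ : ⟪-ε • toLp 2 (q, τ₂), h₂⟫ = -ε * (⟪q, h₂.fst⟫ + τ₂ * h₂.snd) := by
        rw [real_inner_smul_left, prod_inner_apply]
        simp [mul_comm]
      rw [e₁, e₂]
      rw [inner_sub_right] at h
      linarith
  have hε0 := hε.ne'
  have hsub := jetOperator_nonpos hσC2 hgcont hfcont hε husol.1 ht₁
    (by simpa using ⟨hε0, hq⟩) hS₁
  have hsup := jetOperator_nonneg hσC2 hgcont hfcont (neg_lt_zero.mpr hε) husol.2 ht₂
    (by simpa using ⟨hε0, hq⟩) hS₂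
  set X : E n →L[ℝ] E n := ε⁻¹ • spatialBlock S₁ with hX
  set Y : E n →L[ℝ] E n := (-ε)⁻¹ • spatialBlock S₂ with hY
  have hsub' : τ₁ + levelSetH σ g f (P₁ z₁).fst (P₁ z₁).snd q X ≤ 0 := by
    have e₁ : ε⁻¹ * (ε • toLp 2 (q, τ₁) : SpaceTime n).snd = τ₁ := by
      simp [hε0]
    have e₂ : ε⁻¹ • (ε • toLp 2 (q, τ₁) : SpaceTime n).fst = q := by
      simp [smul_smul, hε0]
    simpa only [jetOperator, e₁, e₂] using hsub
  have hsup' : 0 ≤ τ₂ + levelSetH σ g f (P₂ z₂).fst (P₂ z₂).snd q Y := by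
    have e₁ : (-ε)⁻¹ * (-ε • toLp 2 (q, τ₂) : SpaceTime n).snd = τ₂ := by
      simp [hε0]
    have e₂ : (-ε)⁻¹ • (-ε • toLp 2 (q, τ₂) : SpaceTime n).fst = q := by
      simp [smul_smul, inv_neg, hε0]
    simpa only [jetOperator, e₁, e₂] using hsup
  have hblock : ∀ S : SpaceTime n →L[ℝ] SpaceTime n, (∀ x y, ⟪S x, y⟫ = ⟪x, S y⟫) →
      ∀ c : ℝ, ∀ x y, ⟪(c • spatialBlock S) x, y⟫ = ⟪x, (c • spatialBlock S) y⟫ := by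
    intro S hS c x y
    rw [smul_apply, smul_apply, real_inner_smul_left, real_inner_smul_right, inner_spatialBlock,
      hS, real_inner_comm, ← inner_spatialBlock, real_inner_comm]
  have htr : trComp (hessian σ q) X ≤ trComp (hessian σ q) Y := by
    refine trComp_le_trComp
      (hσconv.inner_hessian_nonneg (hσC2.contDiffAt (isOpen_ne.mem_nhds hq)))
      (hblock S₁ (symm_of_mem_closure_isSuperjet hS₁) _)
      (hblock S₂ (symm_of_mem_closure_isSuperjet hS₂) _) fun v => ?_
    have h := hS (spaceIncl n v) (spaceIncl n v)
    rw [norm_sq_add_sub_spaceProj] at h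
    simp only [spaceIncl_apply, sub_self, norm_zero] at h
    simp only [hX, hY, smul_apply, real_inner_smul_left, inner_spatialBlock, spaceIncl_apply,
      inv_neg]
    have h2 := mul_le_mul_of_nonneg_left h (inv_pos.mpr hε).le
    simp only [toLp_snd] at h2
    nlinarith
  have hunit : ‖‖q‖⁻¹ • q‖ = 1 := by simp [norm_smul, norm_ne_zero_iff.mpr hq]
  set F₁ := f (P₁ z₁).fst (P₁ z₁).snd
  set F₂ := f (P₂ z₂).fst (P₂ z₂).snd
  have h1 : g (‖q‖⁻¹ • q) (-(trComp (hessian σ q) Y) + F₁)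
      ≤ g (‖q‖⁻¹ • q) (-(trComp (hessian σ q) X) + F₁) := hgmono _ hunit (by linarith)
  have h2 := (abs_le.mp (hLg _ hunit (-(trComp (hessian σ q) Y) + F₁)
    (-(trComp (hessian σ q) Y) + F₂))).1
  rw [add_sub_add_left_eq_sub] at h2
  have h3 := mul_le_mul_of_nonneg_left (h2.trans (sub_le_sub_right h1 _)) (norm_nonneg q)
  simp only [levelSetH] at hsub' hsup'
  linarith

/-- The penalization used in the doubling of variables. -/
def penalty (A M β k s ε : ℝ) (z₁ z₂ : SpaceTime n) : ℝ :=
  A * Real.exp (M * z₁.snd) * ‖z₁.fst - z₂.fst‖ + (z₁.snd - z₂.snd) ^ 2 / (2 * ε)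
    + β * Real.exp (k * (z₁.snd - s))

lemma continuous_penalty (A M β k s ε : ℝ) :
    Continuous fun Z : SpaceTime n × SpaceTime n => penalty A M β k s ε Z.1 Z.2 := by
  have c1 : Continuous fun z : SpaceTime n => z.fst := (fstL 2 ℝ (E n) ℝ).continuous
  have c2 : Continuous fun z : SpaceTime n => z.snd := (sndL 2 ℝ (E n) ℝ).continuous
  have a1 := c1.comp (continuous_fst (X := SpaceTime n) (Y := SpaceTime n))
  have a2 := c1.comp (continuous_snd (X := SpaceTime n) (Y := SpaceTime n))
  have b1 := c2.comp (continuous_fst (X := SpaceTime n) (Y := SpaceTime n))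
  have b2 := c2.comp (continuous_snd (X := SpaceTime n) (Y := SpaceTime n))
  have e1 : Continuous fun Z : SpaceTime n × SpaceTime n =>
      A * Real.exp (M * Z.1.snd) * ‖Z.1.fst - Z.2.fst‖ :=
    ((Real.continuous_exp.comp (b1.const_mul M)).const_mul A).mul (a1.sub a2).norm
  have e2 : Continuous fun Z : SpaceTime n × SpaceTime n =>
      (Z.1.snd - Z.2.snd) ^ 2 / (2 * ε) := ((b1.sub b2).pow 2).div_const _
  have e3 : Continuous fun Z : SpaceTime n × SpaceTime n =>
      β * Real.exp (k * (Z.1.snd - s)) :=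
    (Real.continuous_exp.comp ((b1.sub continuous_const).const_mul k)).const_mul β
  exact (e1.add e2).add e3

lemma norm_add_le_expansion {F : Type*} [NormedAddCommGroup F] [InnerProductSpace ℝ F] {v : F}
    (hv : v ≠ 0) (δ : F) :
    ‖v + δ‖ ≤ ‖v‖ + ⟪‖v‖⁻¹ • v, δ⟫ + ‖δ‖ ^ 2 / (2 * ‖v‖) := by
  have hv0 : 0 < ‖v‖ := norm_pos_iff.mpr hv
  have h1 := norm_add_sq_real v δ
  have h2 : 2 * ‖v‖ * (‖v‖ + ⟪‖v‖⁻¹ • v, δ⟫ + ‖δ‖ ^ 2 / (2 * ‖v‖))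
      = ‖v‖ ^ 2 + ‖v + δ‖ ^ 2 := by
    rw [h1, real_inner_smul_left]
    field_simp
    ring
  refine le_of_mul_le_mul_left ?_ (show 0 < 2 * ‖v‖ by positivity)
  rw [h2]
  nlinarith [sq_nonneg (‖v‖ - ‖v + δ‖)]

lemma penalty_expansion {A M β k s ε : ℝ} (hA : 0 ≤ A) (hM : 0 ≤ M) (hβ : 0 ≤ β) (hk : 0 ≤ k)
    (hε : 0 < ε) {z₁ z₂ : SpaceTime n} (hz : z₁.fst - z₂.fst ≠ 0) :
    ∃ C ≥ 0, ∃ ρ > 0, ∀ h₁ h₂ : SpaceTime n, ‖h₁‖ ≤ ρ → ‖h₂‖ ≤ ρ →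
      penalty A M β k s ε z₁ z₂
        + (⟪(A * Real.exp (M * z₁.snd)) • ‖z₁.fst - z₂.fst‖⁻¹ • (z₁.fst - z₂.fst),
              h₁.fst - h₂.fst⟫
          + (A * Real.exp (M * z₁.snd) * M * ‖z₁.fst - z₂.fst‖ + (z₁.snd - z₂.snd) / ε
              + β * Real.exp (k * (z₁.snd - s)) * k) * h₁.snd
          - (z₁.snd - z₂.snd) / ε * h₂.snd)
        + C * (‖h₁.fst - h₂.fst‖ ^ 2 + h₁.snd ^ 2 + h₂.snd ^ 2)
      ≥ penalty A M β k s ε (z₁ + h₁) (z₂ + h₂) := by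
  set v := z₁.fst - z₂.fst with hv
  have hv0 : 0 < ‖v‖ := norm_pos_iff.mpr hz
  set lam := A * Real.exp (M * z₁.snd) with hlam
  set θ := β * Real.exp (k * (z₁.snd - s)) with hθ
  have hlam0 : 0 ≤ lam := by positivity
  have hθ0 : 0 ≤ θ := by positivity
  refine ⟨lam / (2 * ‖v‖) + lam * M ^ 2 * ‖v‖ + lam * M + 1 / ε + θ * k ^ 2, by positivity,
    1 / (M + k + 1), by positivity, fun h₁ h₂ hh₁ _ => ?_⟩
  set a := h₁.snd with ha
  set b := h₂.snd with hb
  set δ := h₁.fst - h₂.fst with hδ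
  have haρ : |a| * (M + k + 1) ≤ 1 := by
    have : |a| ≤ 1 / (M + k + 1) := (norm_snd_le _ h₁).trans hh₁
    rwa [le_div_iff₀ (by positivity)] at this
  have ha0 := abs_nonneg a
  have hMa : |M * a| ≤ 1 := by rw [abs_mul, abs_of_nonneg hM]; nlinarith
  have hka : |k * a| ≤ 1 := by rw [abs_mul, abs_of_nonneg hk]; nlinarith
  have e1 := (abs_le.mp (Real.abs_exp_sub_one_sub_id_le hMa)).2
  have e2 := (abs_le.mp (Real.abs_exp_sub_one_sub_id_le hka)).2
  have e3 := Real.abs_exp_sub_one_le hMa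
  have e4 := norm_add_le_expansion hz δ
  have e5 : (Real.exp (M * a) - 1) * (‖v + δ‖ - ‖v‖) ≤ M * (a ^ 2 + ‖δ‖ ^ 2) := by
    have h1 : |‖v + δ‖ - ‖v‖| ≤ ‖δ‖ := by
      simpa using abs_norm_sub_norm_le (v + δ) v
    calc (Real.exp (M * a) - 1) * (‖v + δ‖ - ‖v‖)
        ≤ |Real.exp (M * a) - 1| * |‖v + δ‖ - ‖v‖| := by rw [← abs_mul]; exact le_abs_self _
      _ ≤ (2 * |M * a|) * ‖δ‖ := by gcongr
      _ = M * (2 * |a| * ‖δ‖) := by rw [abs_mul, abs_of_nonneg hM]; ring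
      _ ≤ M * (a ^ 2 + ‖δ‖ ^ 2) := by
        gcongr
        nlinarith [sq_nonneg (|a| - ‖δ‖), sq_abs a]
  have hexpand : penalty A M β k s ε (z₁ + h₁) (z₂ + h₂)
      = lam * (‖v + δ‖ + (Real.exp (M * a) - 1) * ‖v‖
          + (Real.exp (M * a) - 1) * (‖v + δ‖ - ‖v‖))
        + (z₁.snd - z₂.snd + (a - b)) ^ 2 / (2 * ε) + θ * Real.exp (k * a) := by
    have h1 : z₁.fst + h₁.fst - (z₂.fst + h₂.fst) = v + δ := by rw [hv, hδ]; abel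
    have h2 : M * (z₁.snd + a) = M * z₁.snd + M * a := by ring
    have h3 : k * (z₁.snd + a - s) = k * (z₁.snd - s) + k * a := by ring
    simp only [penalty, add_fst, add_snd, h1, ← ha, ← hb, h2, h3, Real.exp_add, hlam, hθ]
    ring
  rw [hexpand]
  have hsq : (z₁.snd - z₂.snd + (a - b)) ^ 2 / (2 * ε)
      ≤ (z₁.snd - z₂.snd) ^ 2 / (2 * ε) + (z₁.snd - z₂.snd) / ε * a
        - (z₁.snd - z₂.snd) / ε * b + 1 / ε * (a ^ 2 + b ^ 2) := by
    have : (z₁.snd - z₂.snd) ^ 2 / (2 * ε) + (z₁.snd - z₂.snd) / ε * a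
        - (z₁.snd - z₂.snd) / ε * b + 1 / ε * (a ^ 2 + b ^ 2)
        - (z₁.snd - z₂.snd + (a - b)) ^ 2 / (2 * ε) = (a + b) ^ 2 / (2 * ε) := by
      field_simp
      ring
    have h0 : 0 ≤ (a + b) ^ 2 / (2 * ε) := by positivity
    linarith
  have hl : lam * (‖v + δ‖ + (Real.exp (M * a) - 1) * ‖v‖
          + (Real.exp (M * a) - 1) * (‖v + δ‖ - ‖v‖))
      ≤ lam * ((‖v‖ + ⟪‖v‖⁻¹ • v, δ⟫ + ‖δ‖ ^ 2 / (2 * ‖v‖)) + (M * a + (M * a) ^ 2) * ‖v‖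
          + M * (a ^ 2 + ‖δ‖ ^ 2)) := by
    gcongr
    linarith
  have hθe : θ * Real.exp (k * a) ≤ θ * (1 + k * a + (k * a) ^ 2) := by
    gcongr
    linarith
  have hpen : penalty A M β k s ε z₁ z₂
      = lam * ‖v‖ + (z₁.snd - z₂.snd) ^ 2 / (2 * ε) + θ := rfl
  rw [hpen, real_inner_smul_left]
  have hrest : 0 ≤ (lam / (2 * ‖v‖)) * (a ^ 2 + b ^ 2) + lam * M ^ 2 * ‖v‖ * (‖δ‖ ^ 2 + b ^ 2)
      + lam * M * b ^ 2 + 1 / ε * ‖δ‖ ^ 2 + θ * k ^ 2 * (‖δ‖ ^ 2 + b ^ 2) := by positivity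
  have hdiv : lam * (‖δ‖ ^ 2 / (2 * ‖v‖)) = lam / (2 * ‖v‖) * ‖δ‖ ^ 2 := by ring
  linarith

end DoublingVariables

section Maximization

open WithLp

variable {n : ℕ}

lemma isClosed_timeStrip (T : ℝ) : IsClosed (timeStrip n T) :=
  isClosed_Icc.preimage (sndL 2 ℝ (E n) ℝ).continuous

lemma exists_modulus_of_continuousOn {T : ℝ} {h : E n → ℝ → ℝ}
    (hh : ContinuousOn (fun q : E n × ℝ => h q.1 q.2) (univ ×ˢ Icc 0 T)) (ρ : ℝ) {η : ℝ}
    (hη : 0 < η) :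
    ∃ δ > 0, ∀ x y : E n, ‖x‖ ≤ ρ → ‖y‖ ≤ ρ → ∀ t ∈ Icc (0 : ℝ) T, ∀ s ∈ Icc (0 : ℝ) T,
      ‖x - y‖ ≤ δ → |t - s| ≤ δ → |h x t - h y s| ≤ η := by
  have hK : IsCompact (closedBall (0 : E n) ρ ×ˢ Icc (0 : ℝ) T) :=
    (isCompact_closedBall _ _).prod isCompact_Icc
  have huc := hK.uniformContinuousOn_of_continuous
    (hh.mono (prod_mono_left (subset_univ _)))
  obtain ⟨δ, hδ, hb⟩ := Metric.uniformContinuousOn_iff.mp huc η hη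
  refine ⟨δ / 2, by positivity, fun x y hx hy t ht s hs hxy hts => ?_⟩
  have := hb (x, t) ⟨by simpa using hx, ht⟩ (y, s) ⟨by simpa using hy, hs⟩ (by
    rw [Prod.dist_eq, max_lt_iff, dist_eq_norm, Real.dist_eq]
    constructor <;> simp only <;> linarith)
  rw [Real.dist_eq] at this
  exact this.le

lemma exists_modulus_of_const_outside {T R c : ℝ} {u : E n → ℝ → ℝ}
    (hu : ContinuousOn (fun q : E n × ℝ => u q.1 q.2) (univ ×ˢ Icc 0 T))
    (hc : ∀ x : E n, ∀ t ∈ Icc (0 : ℝ) T, R ≤ ‖x‖ → u x t = c) {η : ℝ} (hη : 0 < η) :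
    ∃ δ > 0, ∀ x y : E n, ∀ t ∈ Icc (0 : ℝ) T, ∀ s ∈ Icc (0 : ℝ) T,
      ‖x - y‖ ≤ δ → |t - s| ≤ δ → |u x t - u y s| ≤ η := by
  obtain ⟨δ, hδ, hb⟩ := exists_modulus_of_continuousOn hu (R + 1) hη
  refine ⟨min δ 1, by positivity, fun x y t ht s hs hxy hts => ?_⟩
  have h1 := hxy.trans (min_le_right _ _)
  have h2 := abs_le.mp ((abs_norm_sub_norm_le x y).trans h1)
  by_cases hx : ‖x‖ ≤ R + 1
  · by_cases hy : ‖y‖ ≤ R + 1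
    · exact hb x y hx hy t ht s hs (hxy.trans (min_le_left _ _)) (hts.trans (min_le_left _ _))
    · rw [hc x t ht (by linarith), hc y s hs (by linarith), sub_self, abs_zero]
      exact hη.le
  · rw [hc x t ht (by linarith), hc y s hs (by linarith), sub_self, abs_zero]
    exact hη.le

lemma exists_bound_of_const_outside {T R c : ℝ} {u : E n → ℝ → ℝ}
    (hu : ContinuousOn (fun q : E n × ℝ => u q.1 q.2) (univ ×ˢ Icc 0 T))
    (hc : ∀ x : E n, ∀ t ∈ Icc (0 : ℝ) T, R ≤ ‖x‖ → u x t = c) :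
    ∃ K > 0, ∀ x : E n, ∀ t ∈ Icc (0 : ℝ) T, |u x t| ≤ K := by
  obtain ⟨K, hK⟩ := ((isCompact_closedBall (0 : E n) R).prod
    (isCompact_Icc (a := (0 : ℝ)) (b := T))).exists_bound_of_continuousOn
    (hu.mono (prod_mono_left (subset_univ _)))
  refine ⟨|K| + |c| + 1, by positivity, fun x t ht => ?_⟩
  rcases le_or_gt R ‖x‖ with hx | hx
  · rw [hc x t ht hx]
    linarith [abs_nonneg K]
  · have h1 := hK (x, t) ⟨by simpa using hx.le, ht⟩
    rw [Real.norm_eq_abs] at h1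
    linarith [abs_nonneg c, le_abs_self K]

lemma exists_isProxSelection {V : Type*} [NormedAddCommGroup V] [InnerProductSpace ℝ V]
    [FiniteDimensional ℝ V] {a : V → ℝ} {Ω : Set V} (hΩ : IsClosed Ω) (hne : Ω.Nonempty)
    (ha : ContinuousOn a Ω) {K : ℝ} (hK : ∀ w ∈ Ω, |a w| ≤ K) :
    ∃ P, IsProxSelection a Ω P := by
  obtain ⟨w₀, hw₀⟩ := hne
  have hmax : ∀ z, ∃ p ∈ Ω, ∀ w ∈ Ω,
      a w - 1 / 2 * ‖w - z‖ ^ 2 ≤ a p - 1 / 2 * ‖p - z‖ ^ 2 := by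
    intro z
    refine ContinuousOn.exists_isMaxOn' (f := fun w => a w - 1 / 2 * ‖w - z‖ ^ 2)
      (ha.sub (by fun_prop)) hΩ hw₀ ?_
    have h1 : ∀ᶠ w in cocompact V, 2 * K + ‖w₀ - z‖ ^ 2 + 1 + ‖z‖ ≤ ‖w‖ :=
      (tendsto_norm_cocompact_atTop (E := V)).eventually_ge_atTop _
    filter_upwards [h1.filter_mono inf_le_left, mem_inf_of_right (mem_principal_self Ω)]
      with w hw hwΩ
    have h2 := abs_le.mp (hK w hwΩ)
    have h3 := abs_le.mp (hK w₀ hw₀)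
    have h4 := norm_sub_norm_le w z
    have h5 : 2 * K + ‖w₀ - z‖ ^ 2 + 1 ≤ ‖w - z‖ := by linarith
    have h6 := sq_nonneg ‖w₀ - z‖
    have h7 : 0 ≤ K := by linarith
    nlinarith [sq_nonneg (‖w - z‖ - 2)]
  choose P hP using hmax
  exact ⟨P, hP⟩

lemma IsProxSelection.continuous_proxValue {V : Type*} [NormedAddCommGroup V]
    [InnerProductSpace ℝ V] [FiniteDimensional ℝ V] {a : V → ℝ} {Ω : Set V} {P : V → V}
    (hP : IsProxSelection a Ω P) : Continuous (proxValue a P) := by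
  have h := hP.isSubgradientSelection.continuous.sub
    (by fun_prop : Continuous fun z : V => 1 / 2 * ‖z‖ ^ 2)
  exact h.congr fun z => by simp

/-- Consequences of a lower bound for the doubled and penalized function. -/
lemma level_estimates {T K A M β k s ε r m : ℝ} {u : E n → ℝ → ℝ} (hA : 0 ≤ A) (hβ : 0 ≤ β)
    (hm : 0 < m) (hr : 0 < r) (hK0 : 0 < K) (hε : ε = r ^ 2 / (4 * K))
    (hK : ∀ x : E n, ∀ t ∈ Icc (0 : ℝ) T, |u x t| ≤ K) {P₁ P₂ : SpaceTime n → SpaceTime n}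
    (hP₁ : IsProxSelection (fun w => ε * u w.fst w.snd) (timeStrip n T) P₁)
    (hP₂ : IsProxSelection (fun w => -ε * u w.fst w.snd) (timeStrip n T) P₂)
    {z₁ z₂ : SpaceTime n}
    (hlevel : ε * m ≤ proxValue (fun w => ε * u w.fst w.snd) P₁ z₁
      + proxValue (fun w => -ε * u w.fst w.snd) P₂ z₂ - ε * penalty A M β k s ε z₁ z₂) :
    ‖P₁ z₁ - z₁‖ ≤ r ∧ ‖P₂ z₂ - z₂‖ ≤ r ∧ |z₁.snd - z₂.snd| ≤ r ∧
    A * Real.exp (M * z₁.snd) * ‖z₁.fst - z₂.fst‖ ≤ 2 * K ∧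
    β * Real.exp (k * (z₁.snd - s)) ≤ 2 * K ∧
    m + A * Real.exp (M * z₁.snd) * ‖z₁.fst - z₂.fst‖
      ≤ u (P₁ z₁).fst (P₁ z₁).snd - u (P₂ z₂).fst (P₂ z₂).snd := by
  have hε0 : 0 < ε := by rw [hε]; positivity
  have hεK : ε * (4 * K) = r ^ 2 := by rw [hε]; field_simp
  have h1 := abs_le.mp (hK (P₁ z₁).fst _ (hP₁ z₁).1)
  have h2 := abs_le.mp (hK (P₂ z₂).fst _ (hP₂ z₂).1)
  set D := u (P₁ z₁).fst (P₁ z₁).snd - u (P₂ z₂).fst (P₂ z₂).snd with hD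
  set B := A * Real.exp (M * z₁.snd) * ‖z₁.fst - z₂.fst‖ with hB
  set θ := β * Real.exp (k * (z₁.snd - s)) with hθ
  have hB0 : 0 ≤ B := by positivity
  have hθ0 : 0 ≤ θ := by positivity
  have hkey : ε * m + 1 / 2 * ‖P₁ z₁ - z₁‖ ^ 2 + 1 / 2 * ‖P₂ z₂ - z₂‖ ^ 2 + ε * B
      + 1 / 2 * (z₁.snd - z₂.snd) ^ 2 + ε * θ ≤ ε * D := by
    have e : ε * ((z₁.snd - z₂.snd) ^ 2 / (2 * ε)) = 1 / 2 * (z₁.snd - z₂.snd) ^ 2 := by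
      field_simp
    simp only [proxValue, penalty] at hlevel
    rw [← hB, ← hθ] at hlevel
    rw [hD]
    linarith
  have hD2 : ε * D ≤ ε * (2 * K) := by gcongr; linarith
  have hεm : 0 < ε * m := by positivity
  have hεB : 0 ≤ ε * B := by positivity
  have hεθ : 0 ≤ ε * θ := by positivity
  have q1 := sq_nonneg ‖P₁ z₁ - z₁‖
  have q2 := sq_nonneg ‖P₂ z₂ - z₂‖
  have q3 := sq_nonneg (z₁.snd - z₂.snd)
  refine ⟨?_, ?_, ?_, ?_, ?_, ?_⟩
  · exact (abs_le_of_sq_le_sq' (by linarith) hr.le).2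
  · exact (abs_le_of_sq_le_sq' (by linarith) hr.le).2
  · exact abs_le_of_sq_le_sq (by linarith) hr.le
  · exact le_of_mul_le_mul_left (by linarith) hε0
  · exact le_of_mul_le_mul_left (by linarith) hε0
  · exact le_of_mul_le_mul_left (by linarith) hε0

lemma exists_max_of_bounded_superlevel {X : Type*} [PseudoMetricSpace X] [ProperSpace X]
    {Φ : X → ℝ} (hΦ : Continuous Φ) {c ρ : ℝ} {x₀ x₁ : X} (hx₁ : c ≤ Φ x₁)
    (hb : ∀ x, c ≤ Φ x → dist x x₀ ≤ ρ) : ∃ y, c ≤ Φ y ∧ ∀ x, Φ x ≤ Φ y := by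
  obtain ⟨y, hy, hmax⟩ := (isCompact_closedBall x₀ ρ).exists_isMaxOn ⟨x₁, hb x₁ hx₁⟩
    hΦ.continuousOn
  have hcy : c ≤ Φ y := hx₁.trans (hmax (hb x₁ hx₁))
  refine ⟨y, hcy, fun x => ?_⟩
  rcases le_total c (Φ x) with hx | hx
  · exact hmax (hb x hx)
  · exact hx.trans hcy

/-- Location of the foot points under the conclusions of `level_estimates`. -/
lemma level_location {T R c K A M r m : ℝ} {u : E n → ℝ → ℝ}
    (hc : ∀ x : E n, ∀ t ∈ Icc (0 : ℝ) T, R ≤ ‖x‖ → u x t = c) (hA : 0 < A) (hM : 0 ≤ M)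
    (hm : 0 < m) (hr1 : r ≤ 1) {w₁ w₂ z₁ z₂ : SpaceTime n}
    (hw₁ : w₁ ∈ timeStrip n T) (hw₂ : w₂ ∈ timeStrip n T)
    (h1 : ‖w₁ - z₁‖ ≤ r) (h2 : ‖w₂ - z₂‖ ≤ r) (h3 : |z₁.snd - z₂.snd| ≤ r)
    (h4 : A * Real.exp (M * z₁.snd) * ‖z₁.fst - z₂.fst‖ ≤ 2 * K)
    (h6 : m + A * Real.exp (M * z₁.snd) * ‖z₁.fst - z₂.fst‖
      ≤ u w₁.fst w₁.snd - u w₂.fst w₂.snd) :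
    |w₁.snd - z₁.snd| ≤ r ∧ |w₁.snd - w₂.snd| ≤ 3 * r ∧
    ‖w₁.fst - w₂.fst‖ ≤ ‖z₁.fst - z₂.fst‖ + 2 * r ∧
    ‖w₁.fst‖ ≤ R + 2 * K / (A * Real.exp (-M)) + 2 ∧
    ‖w₂.fst‖ ≤ R + 2 * K / (A * Real.exp (-M)) + 2 := by
  have s1 : |w₁.snd - z₁.snd| ≤ r := (norm_snd_le _ (w₁ - z₁)).trans h1
  have s2 : |w₂.snd - z₂.snd| ≤ r := (norm_snd_le _ (w₂ - z₂)).trans h2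
  have f1 : ‖w₁.fst - z₁.fst‖ ≤ r := (norm_fst_le _ (w₁ - z₁)).trans h1
  have f2 : ‖w₂.fst - z₂.fst‖ ≤ r := (norm_fst_le _ (w₂ - z₂)).trans h2
  have hts : |w₁.snd - w₂.snd| ≤ 3 * r := by
    rw [abs_le] at *
    constructor <;> linarith
  have hxy : ‖w₁.fst - w₂.fst‖ ≤ ‖z₁.fst - z₂.fst‖ + 2 * r := by
    have e : w₁.fst - w₂.fst = (w₁.fst - z₁.fst) + (z₁.fst - z₂.fst) - (w₂.fst - z₂.fst) := by
      abel
    rw [e]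
    have i1 := norm_sub_le ((w₁.fst - z₁.fst) + (z₁.fst - z₂.fst)) (w₂.fst - z₂.fst)
    have i2 := norm_add_le (w₁.fst - z₁.fst) (z₁.fst - z₂.fst)
    linarith
  have hτ : -1 ≤ z₁.snd := by
    have := hw₁.1
    have := (abs_le.mp s1).2
    linarith
  have hv : ‖z₁.fst - z₂.fst‖ ≤ 2 * K / (A * Real.exp (-M)) := by
    rw [le_div_iff₀ (by positivity), mul_comm]
    refine le_trans ?_ h4
    gcongr
    nlinarith
  have hB : 0 ≤ A * Real.exp (M * z₁.snd) * ‖z₁.fst - z₂.fst‖ := by positivity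
  have hnear : ‖w₁.fst‖ < R ∨ ‖w₂.fst‖ < R := by
    by_contra! hfar
    rw [hc _ _ hw₁ hfar.1, hc _ _ hw₂ hfar.2] at h6
    linarith
  have hn := abs_le.mp (abs_norm_sub_norm_le w₁.fst w₂.fst)
  have hv0 := norm_nonneg (z₁.fst - z₂.fst)
  refine ⟨s1, hts, hxy, ?_, ?_⟩ <;> rcases hnear with h | h <;> linarith

end Maximization

section Comparison

open WithLp

variable {n : ℕ}

/-- The doubled and penalized function, in terms of proximal regularizations of `±ε u`. -/
def doubled (A M β k s ε : ℝ) (u : E n → ℝ → ℝ) (P₁ P₂ : SpaceTime n → SpaceTime n)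
    (Z : SpaceTime n × SpaceTime n) : ℝ :=
  proxValue (fun w => ε * u w.fst w.snd) P₁ Z.1 + proxValue (fun w => -ε * u w.fst w.snd) P₂ Z.2
    - ε * penalty A M β k s ε Z.1 Z.2

lemma norm_le_abs_fst_add_abs_snd (w : SpaceTime n) : ‖w‖ ≤ ‖w.fst‖ + |w.snd| := by
  refine abs_le_of_sq_le_sq' ?_ (by positivity) |>.2
  rw [prod_norm_sq_eq_of_L2, Real.norm_eq_abs]
  nlinarith [mul_nonneg (norm_nonneg w.fst) (abs_nonneg w.snd)]

lemma exists_isProxSelection_timeStrip {T K ε : ℝ} (hT : 0 < T) {u : E n → ℝ → ℝ}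
    (hucont : ContinuousOn (fun q : E n × ℝ => u q.1 q.2) (univ ×ˢ Icc 0 T))
    (hK : ∀ x : E n, ∀ t ∈ Icc (0 : ℝ) T, |u x t| ≤ K) :
    ∃ P, IsProxSelection (fun w => ε * u w.fst w.snd) (timeStrip n T) P := by
  have hcont : ContinuousOn (fun w : SpaceTime n => u w.fst w.snd) (timeStrip n T) := by
    have h : ContinuousOn (fun w : SpaceTime n => (w.fst, w.snd)) (timeStrip n T) :=
      ((fstL 2 ℝ (E n) ℝ).continuous.prodMk (sndL 2 ℝ (E n) ℝ).continuous).continuousOn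
    exact hucont.comp h fun w hw => ⟨mem_univ _, hw⟩
  refine exists_isProxSelection (K := |ε| * K) (isClosed_timeStrip T)
    ⟨toLp 2 (0, 0), ⟨le_rfl, hT.le⟩⟩ (hcont.const_mul ε) fun w hw => ?_
  rw [abs_mul]
  exact mul_le_mul_of_nonneg_left (hK _ _ hw) (abs_nonneg _)

lemma exists_max_doubled {T R c K A M β k s ε r m : ℝ} {u : E n → ℝ → ℝ}
    (hc : ∀ x : E n, ∀ t ∈ Icc (0 : ℝ) T, R ≤ ‖x‖ → u x t = c) (hA : 0 < A) (hM : 0 ≤ M)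
    (hβ : 0 ≤ β) (hm : 0 < m) (hr : 0 < r) (hr1 : r ≤ 1) (hK0 : 0 < K) (hε : ε = r ^ 2 / (4 * K))
    (hK : ∀ x : E n, ∀ t ∈ Icc (0 : ℝ) T, |u x t| ≤ K) {P₁ P₂ : SpaceTime n → SpaceTime n}
    (hP₁ : IsProxSelection (fun w => ε * u w.fst w.snd) (timeStrip n T) P₁)
    (hP₂ : IsProxSelection (fun w => -ε * u w.fst w.snd) (timeStrip n T) P₂)
    {x y : E n} (hs : s ∈ Icc (0 : ℝ) T)
    (hgap : m + β + A * Real.exp (M * s) * ‖x - y‖ ≤ u x s - u y s) :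
    ∃ Z, ε * m ≤ doubled A M β k s ε u P₁ P₂ Z ∧
      ∀ Z', doubled A M β k s ε u P₁ P₂ Z' ≤ doubled A M β k s ε u P₁ P₂ Z := by
  have hε0 : 0 < ε := by rw [hε]; positivity
  have hcont : Continuous (doubled A M β k s ε u P₁ P₂) :=
    ((hP₁.continuous_proxValue.comp continuous_fst).add
      (hP₂.continuous_proxValue.comp continuous_snd)).sub
      ((continuous_penalty A M β k s ε).const_mul ε)
  have hstart : ε * m ≤ doubled A M β k s ε u P₁ P₂ (toLp 2 (x, s), toLp 2 (y, s)) := by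
    have h1 := (hP₁ (toLp 2 (x, s))).2 (toLp 2 (x, s)) hs
    have h2 := (hP₂ (toLp 2 (y, s))).2 (toLp 2 (y, s)) hs
    simp only [sub_self, norm_zero] at h1 h2
    have h3 := mul_le_mul_of_nonneg_left hgap hε0.le
    simp only [doubled, proxValue, penalty]
    simp only [toLp_fst, toLp_snd] at h1 h2 ⊢
    norm_num at h1 h2 ⊢
    linarith
  refine exists_max_of_bounded_superlevel hcont hstart (x₀ := 0)
    (ρ := R + 2 * K / (A * Real.exp (-M)) + 3 + T) fun Z hZ => ?_
  obtain ⟨h1, h2, h3, h4, -, h6⟩ := level_estimates hA.le hβ hm hr hK0 hε hK hP₁ hP₂ hZ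
  have hw₁ := (hP₁ Z.1).1
  have hw₂ := (hP₂ Z.2).1
  obtain ⟨-, -, -, b1, b2⟩ := level_location hc hA hM hm hr1 hw₁ hw₂ h1 h2 h3 h4 h6
  have key : ∀ w z : SpaceTime n, w ∈ timeStrip n T → ‖w - z‖ ≤ r →
      ‖w.fst‖ ≤ R + 2 * K / (A * Real.exp (-M)) + 2 →
      ‖z‖ ≤ R + 2 * K / (A * Real.exp (-M)) + 3 + T := by
    intro w z hw hwz hb
    have i1 := norm_le_abs_fst_add_abs_snd w
    rw [abs_of_nonneg hw.1] at i1
    have i2 := norm_sub_norm_le z w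
    rw [norm_sub_rev] at i2
    have i3 : w.snd ≤ T := hw.2
    linarith
  rw [dist_zero_right, Prod.norm_def]
  exact max_le (key _ _ hw₁ h1 b1) (key _ _ hw₂ h2 b2)

lemma slope_le_of_max_doubled {T : ℝ} {σ : E n → ℝ}
    (hσC2 : ContDiffOn ℝ 2 σ {x : E n | x ≠ 0}) (hσconv : ConvexOn ℝ univ σ) {g : E n → ℝ → ℝ}
    (hgcont : ContinuousOn (fun q : E n × ℝ => g q.1 q.2) ({p : E n | ‖p‖ = 1} ×ˢ univ))
    {Lg : ℝ} (hLg : ∀ p : E n, ‖p‖ = 1 → ∀ ξ₁ ξ₂, |g p ξ₁ - g p ξ₂| ≤ Lg * |ξ₁ - ξ₂|)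
    (hgmono : ∀ p : E n, ‖p‖ = 1 → Monotone (g p)) {f : E n → ℝ → ℝ}
    (hfcont : ContinuousOn (fun q : E n × ℝ => f q.1 q.2) (univ ×ˢ Icc 0 T))
    {u : E n → ℝ → ℝ} (husol : IsViscSolnE σ g f (univ ×ˢ Ioo 0 T) u)
    {A M β k s ε : ℝ} (hA : 0 < A) (hM : 0 ≤ M) (hβ : 0 ≤ β) (hk : 0 ≤ k) (hε : 0 < ε)
    {P₁ P₂ : SpaceTime n → SpaceTime n}
    (hP₁ : IsProxSelection (fun w => ε * u w.fst w.snd) (timeStrip n T) P₁)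
    (hP₂ : IsProxSelection (fun w => -ε * u w.fst w.snd) (timeStrip n T) P₂)
    {Z : SpaceTime n × SpaceTime n}
    (hmax : ∀ Z', doubled A M β k s ε u P₁ P₂ Z' ≤ doubled A M β k s ε u P₁ P₂ Z)
    (hz : Z.1.fst - Z.2.fst ≠ 0) (ht₁ : (P₁ Z.1).snd ∈ Ioo 0 T) (ht₂ : (P₂ Z.2).snd ∈ Ioo 0 T) :
    A * Real.exp (M * Z.1.snd) * M * ‖Z.1.fst - Z.2.fst‖
        + β * Real.exp (k * (Z.1.snd - s)) * k
      ≤ A * Real.exp (M * Z.1.snd)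
        * (Lg * |f (P₁ Z.1).fst (P₁ Z.1).snd - f (P₂ Z.2).fst (P₂ Z.2).snd|) := by
  obtain ⟨C, hC, ρ, hρ, hexp⟩ := penalty_expansion (s := s) hA.le hM hβ hk hε hz
  have hnorm : 0 < ‖Z.1.fst - Z.2.fst‖ := norm_pos_iff.mpr hz
  have hlam : 0 < A * Real.exp (M * Z.1.snd) := by positivity
  have hq : ‖(A * Real.exp (M * Z.1.snd)) • ‖Z.1.fst - Z.2.fst‖⁻¹ • (Z.1.fst - Z.2.fst)‖
      = A * Real.exp (M * Z.1.snd) := by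
    rw [norm_smul, norm_smul, norm_inv, norm_norm, inv_mul_cancel₀ hnorm.ne', mul_one,
      Real.norm_of_nonneg hlam.le]
  have hq0 : (A * Real.exp (M * Z.1.snd)) • ‖Z.1.fst - Z.2.fst‖⁻¹ • (Z.1.fst - Z.2.fst) ≠ 0 := by
    rw [← norm_pos_iff, hq]
    exact hlam
  have h := time_slope_sub_le hσC2 hσconv hgcont hLg hgmono hfcont husol hε hP₁ hP₂ hq0
    (C := ε * C) (mul_nonneg hε.le hC) hρ ht₁ ht₂
    (τ₁ := A * Real.exp (M * Z.1.snd) * M * ‖Z.1.fst - Z.2.fst‖ + (Z.1.snd - Z.2.snd) / ε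
      + β * Real.exp (k * (Z.1.snd - s)) * k) (τ₂ := (Z.1.snd - Z.2.snd) / ε)
    fun h₁ h₂ hh₁ hh₂ => by
      have i1 := hmax (Z.1 + h₁, Z.2 + h₂)
      have i2 := mul_le_mul_of_nonneg_left (hexp h₁ h₂ hh₁ hh₂) hε.le
      simp only [doubled] at i1
      linarith
  rw [hq] at h
  linarith

end Comparison

section Gap

variable {n : ℕ}

lemma exists_small_radius {δ₁ δ₂ d m L A M Lf e : ℝ} (hδ₁ : 0 < δ₁) (hδ₂ : 0 < δ₂) (hd : 0 < d)
    (hm : 0 < m) (hLA : L < A) (he : 0 < e) :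
    ∃ r > 0, r ≤ 1 ∧ 3 * r ≤ δ₁ ∧ 3 * r ≤ δ₂ ∧ 2 * r ≤ d ∧ 4 * L * r < m ∧
      L ≤ A * Real.exp (-M * r) ∧ 2 * Lf * r ≤ e := by
  have ev : ∀ {φ : ℝ → ℝ} {b : ℝ}, Continuous φ → φ 0 < b → ∀ᶠ r in 𝓝[>] (0 : ℝ), φ r < b :=
    fun hφ h => nhdsWithin_le_nhds (hφ.continuousAt.eventually (gt_mem_nhds h))
  have e1 := ev (φ := fun r => r) (b := 1) (by fun_prop) (by simp)
  have e2 := ev (φ := fun r => 3 * r) (b := δ₁) (by fun_prop) (by simpa)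
  have e3 := ev (φ := fun r => 3 * r) (b := δ₂) (by fun_prop) (by simpa)
  have e4 := ev (φ := fun r => 2 * r) (b := d) (by fun_prop) (by simpa)
  have e5 := ev (φ := fun r => 4 * L * r) (b := m) (by fun_prop) (by simpa)
  have e6 := ev (φ := fun r => L - A * Real.exp (-M * r)) (b := 0) (by fun_prop) (by simpa)
  have e7 := ev (φ := fun r => 2 * Lf * r) (b := e) (by fun_prop) (by simpa)
  obtain ⟨r, hr0, h1, h2, h3, h4, h5, h6, h7⟩ := (eventually_mem_nhdsWithin.and
    (e1.and (e2.and (e3.and (e4.and (e5.and (e6.and e7))))))).exists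
  exact ⟨r, hr0, h1.le, h2.le, h3.le, h4.le, h5, by linarith, h7.le⟩

/-- The foot points of a maximizer avoid the diagonal and the initial and terminal times. -/
lemma interior_of_level {T K A M β k s t₁ L r m δ : ℝ} {u : E n → ℝ → ℝ} (hA : 0 < A)
    (hM : 0 ≤ M) (hβ : 0 < β) (hk : 0 ≤ k) (hm : 0 < m) (hr : 0 < r) (hL0 : 0 ≤ L)
    (hL : ∀ x y, |u x 0 - u y 0| ≤ L * ‖x - y‖)
    (hδ : ∀ x y : E n, ∀ t ∈ Icc (0 : ℝ) T, ∀ s ∈ Icc (0 : ℝ) T,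
      ‖x - y‖ ≤ δ → |t - s| ≤ δ → |u x t - u y s| ≤ m / 4)
    (hrδ : 3 * r ≤ δ) (hrT : 2 * r ≤ T - t₁) (hrL : 4 * L * r < m)
    (hrA : L ≤ A * Real.exp (-M * r)) (hβK : 2 * K < β * Real.exp (k * (t₁ - s)))
    {w₁ w₂ z₁ z₂ : SpaceTime n} (hw₁ : w₁ ∈ timeStrip n T) (hw₂ : w₂ ∈ timeStrip n T)
    (h1 : |w₁.snd - z₁.snd| ≤ r) (h2 : |w₂.snd - z₂.snd| ≤ r) (h3 : |z₁.snd - z₂.snd| ≤ r)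
    (h4 : ‖w₁.fst - w₂.fst‖ ≤ ‖z₁.fst - z₂.fst‖ + 2 * r) (h5 : |w₁.snd - w₂.snd| ≤ 3 * r)
    (h6 : β * Real.exp (k * (z₁.snd - s)) ≤ 2 * K)
    (h7 : m + A * Real.exp (M * z₁.snd) * ‖z₁.fst - z₂.fst‖
      ≤ u w₁.fst w₁.snd - u w₂.fst w₂.snd) :
    z₁.fst - z₂.fst ≠ 0 ∧ w₁.snd ∈ Ioo 0 T ∧ w₂.snd ∈ Ioo 0 T := by
  have hT0 : (0 : ℝ) ∈ Icc 0 T := ⟨le_rfl, hw₁.1.trans hw₁.2⟩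
  have a1 := abs_le.mp h1
  have a2 := abs_le.mp h2
  have a3 := abs_le.mp h3
  have a5 := abs_le.mp h5
  have hB : 0 ≤ A * Real.exp (M * z₁.snd) * ‖z₁.fst - z₂.fst‖ := by positivity
  have p1 : 0 ≤ w₁.snd := hw₁.1
  have p2 : 0 ≤ w₂.snd := hw₂.1
  have hpos : ¬ (w₁.snd ≤ 3 * r ∧ w₂.snd ≤ 3 * r) := by
    rintro ⟨b1, b2⟩
    have c1 := abs_le.mp (hδ w₁.fst w₁.fst _ hw₁ 0 hT0
      (by rw [sub_self, norm_zero]; linarith) (by rw [sub_zero, abs_of_nonneg p1]; linarith))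
    have c2 := abs_le.mp (hδ w₂.fst w₂.fst _ hw₂ 0 hT0
      (by rw [sub_self, norm_zero]; linarith) (by rw [sub_zero, abs_of_nonneg p2]; linarith))
    have c3 := abs_le.mp (hL w₁.fst w₂.fst)
    have c4 := mul_le_mul_of_nonneg_left h4 hL0
    have c5 : L ≤ A * Real.exp (M * z₁.snd) := by
      refine hrA.trans (mul_le_mul_of_nonneg_left (Real.exp_le_exp.mpr ?_) hA.le)
      rw [neg_mul, ← mul_neg]
      exact mul_le_mul_of_nonneg_left (by linarith) hM
    have c6 := mul_le_mul_of_nonneg_right c5 (norm_nonneg (z₁.fst - z₂.fst))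
    linarith
  have hterm : z₁.snd < t₁ := by
    by_contra! hτ
    have : β * Real.exp (k * (t₁ - s)) ≤ β * Real.exp (k * (z₁.snd - s)) :=
      mul_le_mul_of_nonneg_left
        (Real.exp_le_exp.mpr (mul_le_mul_of_nonneg_left (by linarith) hk)) hβ.le
    linarith
  refine ⟨fun hz => ?_, ⟨?_, by linarith⟩, ⟨?_, by linarith⟩⟩
  · rw [hz, norm_zero] at h4
    have := abs_le.mp (hδ w₁.fst w₂.fst _ hw₁ _ hw₂ (by linarith) (by linarith))
    linarith
  · by_contra! h0
    exact hpos ⟨by linarith, by linarith⟩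
  · by_contra! h0
    exact hpos ⟨by linarith, by linarith⟩

lemma sub_le_of_viscSoln {T : ℝ} {σ : E n → ℝ}
    (hσC2 : ContDiffOn ℝ 2 σ {x : E n | x ≠ 0}) (hσconv : ConvexOn ℝ univ σ) {g : E n → ℝ → ℝ}
    (hgcont : ContinuousOn (fun q : E n × ℝ => g q.1 q.2) ({p : E n | ‖p‖ = 1} ×ˢ univ))
    {Lg : ℝ} (hLg0 : 0 ≤ Lg)
    (hLg : ∀ p : E n, ‖p‖ = 1 → ∀ ξ₁ ξ₂, |g p ξ₁ - g p ξ₂| ≤ Lg * |ξ₁ - ξ₂|)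
    (hgmono : ∀ p : E n, ‖p‖ = 1 → Monotone (g p)) {f : E n → ℝ → ℝ}
    (hfcont : ContinuousOn (fun q : E n × ℝ => f q.1 q.2) (univ ×ˢ Icc 0 T))
    {Lf : ℝ} (hLf0 : 0 ≤ Lf)
    (hLf : ∀ t ∈ Icc (0 : ℝ) T, ∀ x y, |f x t - f y t| ≤ Lf * ‖x - y‖)
    {u : E n → ℝ → ℝ}
    (hucont : ContinuousOn (fun q : E n × ℝ => u q.1 q.2) (univ ×ˢ Icc 0 T))
    (husol : IsViscSolnE σ g f (univ ×ˢ Ioo 0 T) u) {R c : ℝ}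
    (hc : ∀ x : E n, ∀ t ∈ Icc (0 : ℝ) T, R ≤ ‖x‖ → u x t = c)
    {L : ℝ} (hL0 : 0 ≤ L) (hL : ∀ x y, |u x 0 - u y 0| ≤ L * ‖x - y‖)
    {A : ℝ} (hLA : L < A) {s : ℝ} (hs : s ∈ Ico 0 T) (x y : E n) :
    u x s - u y s ≤ A * Real.exp (Lg * Lf * s) * ‖x - y‖ := by
  by_contra! hgap
  obtain ⟨hs0, hsT⟩ := hs
  have hT : 0 < T := by linarith
  have hA : 0 < A := by linarith
  set M := Lg * Lf with hMdef
  have hM : 0 ≤ M := mul_nonneg hLg0 hLf0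
  obtain ⟨m, hm, hgap'⟩ : ∃ m > 0, m + m + A * Real.exp (M * s) * ‖x - y‖ ≤ u x s - u y s :=
    ⟨(u x s - u y s - A * Real.exp (M * s) * ‖x - y‖) / 2, by linarith, by linarith⟩
  obtain ⟨K, hK0, hK⟩ := exists_bound_of_const_outside hucont hc
  obtain ⟨t₁, hst₁, ht₁T⟩ := exists_between hsT
  obtain ⟨k, hk, hβK⟩ : ∃ k > 0, 2 * K < m * Real.exp (k * (t₁ - s)) := by
    refine ⟨2 * K / m / (t₁ - s), div_pos (by positivity) (by linarith), ?_⟩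
    rw [div_mul_cancel₀ _ (by linarith : t₁ - s ≠ 0)]
    have h1 := Real.add_one_le_exp (2 * K / m)
    have h2 := mul_le_mul_of_nonneg_left h1 hm.le
    have h3 : m * (2 * K / m) = 2 * K := by field_simp
    linarith
  set Λ := A * Real.exp (M * (T + 1)) with hΛdef
  have hΛ : 0 < Λ := by positivity
  set c₀ := m * Real.exp (k * (-1 - s)) * k with hc₀def
  have hc₀ : 0 < c₀ := by positivity
  obtain ⟨e, he, heΛ⟩ : ∃ e > 0, Λ * (Lg * (e + e)) < c₀ := by
    have hQ : 0 < Λ * Lg + 1 := by positivity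
    refine ⟨c₀ / (2 * (Λ * Lg + 1)), by positivity, ?_⟩
    have h1 : Λ * (Lg * (c₀ / (2 * (Λ * Lg + 1)) + c₀ / (2 * (Λ * Lg + 1))))
        = c₀ * (Λ * Lg) / (Λ * Lg + 1) := by
      field_simp
      ring
    rw [h1, div_lt_iff₀ hQ]
    linarith
  obtain ⟨δ₁, hδ₁, hu⟩ := exists_modulus_of_const_outside hucont hc (by positivity : 0 < m / 4)
  obtain ⟨δ₂, hδ₂, hf⟩ := exists_modulus_of_continuousOn hfcont
    (R + 2 * K / (A * Real.exp (-M)) + 2) he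
  obtain ⟨r, hr, hr1, hrδ₁, hrδ₂, hrT, hrL, hrA, hre⟩ := exists_small_radius (M := M) (Lf := Lf)
    hδ₁ hδ₂ (sub_pos.mpr ht₁T) hm hLA he
  obtain ⟨ε, hε⟩ : ∃ ε, ε = r ^ 2 / (4 * K) := ⟨_, rfl⟩
  have hε0 : 0 < ε := by rw [hε]; positivity
  obtain ⟨P₁, hP₁⟩ := exists_isProxSelection_timeStrip (ε := ε) hT hucont hK
  obtain ⟨P₂, hP₂⟩ := exists_isProxSelection_timeStrip (ε := -ε) hT hucont hK
  obtain ⟨Z, hlevel, hmax⟩ := exists_max_doubled (k := k) hc hA hM hm.le hm hr hr1 hK0 hε hK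
    hP₁ hP₂ ⟨hs0, hsT.le⟩ hgap'
  obtain ⟨n1, n2, h3, h4, h5, h6⟩ := level_estimates hA.le hm.le hm hr hK0 hε hK hP₁ hP₂ hlevel
  have hw₁ := (hP₁ Z.1).1
  have hw₂ := (hP₂ Z.2).1
  obtain ⟨s1, hts, hxy, b1, b2⟩ := level_location hc hA hM hm hr1 hw₁ hw₂ n1 n2 h3 h4 h6
  have s2 : |(P₂ Z.2).snd - Z.2.snd| ≤ r := (WithLp.norm_snd_le _ (P₂ Z.2 - Z.2)).trans n2
  obtain ⟨hz, i1, i2⟩ := interior_of_level hA hM hm hk.le hm hr hL0 hL hu hrδ₁ hrT hrL hrA hβK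
    hw₁ hw₂ s1 s2 h3 hxy hts h5 h6
  have hslope := slope_le_of_max_doubled hσC2 hσconv hgcont hLg hgmono hfcont husol hA hM hm.le
    hk.le hε0 hP₁ hP₂ hmax hz i1 i2
  have hτ := abs_le.mp s1
  have hτ₀ : -1 ≤ Z.1.snd := by linarith [i1.1]
  have hτ₁ : Z.1.snd ≤ T + 1 := by linarith [i1.2]
  have hlam : A * Real.exp (M * Z.1.snd) ≤ Λ := by rw [hΛdef]; gcongr
  have hlam0 : 0 < A * Real.exp (M * Z.1.snd) := by positivity
  have hθ : c₀ ≤ m * Real.exp (k * (Z.1.snd - s)) * k := by rw [hc₀def]; gcongr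
  have hfdiff : |f (P₁ Z.1).fst (P₁ Z.1).snd - f (P₂ Z.2).fst (P₂ Z.2).snd|
      ≤ Lf * ‖Z.1.fst - Z.2.fst‖ + (e + e) := by
    have j1 := hLf _ hw₁ (P₁ Z.1).fst (P₂ Z.2).fst
    have j2 := hf (P₂ Z.2).fst (P₂ Z.2).fst b2 b2 _ hw₁ _ hw₂
      (by rw [sub_self, norm_zero]; exact hδ₂.le) (hts.trans hrδ₂)
    have j3 := abs_sub_le (f (P₁ Z.1).fst (P₁ Z.1).snd) (f (P₂ Z.2).fst (P₁ Z.1).snd)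
      (f (P₂ Z.2).fst (P₂ Z.2).snd)
    have j4 := mul_le_mul_of_nonneg_left hxy hLf0
    linarith
  have k1 := mul_le_mul_of_nonneg_left (mul_le_mul_of_nonneg_left hfdiff hLg0) hlam0.le
  have k2 : A * Real.exp (M * Z.1.snd) * (Lg * (e + e)) ≤ Λ * (Lg * (e + e)) :=
    mul_le_mul_of_nonneg_right hlam (by positivity)
  have k3 : A * Real.exp (M * Z.1.snd) * M * ‖Z.1.fst - Z.2.fst‖
      = A * Real.exp (M * Z.1.snd) * (Lg * (Lf * ‖Z.1.fst - Z.2.fst‖)) := by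
    rw [hMdef]
    ring
  linarith

end Gap

/-- Theorem 4.1 / Theorem L of the paper: uniform spatial Lipschitz
bound for viscosity solutions of the level-set equation (E). -/
theorem spatial_lipschitz_bound
    {n : ℕ} (hn : 1 ≤ n) (T : ℝ) (hT : 0 < T)
    (σ : E n → ℝ) (hσC2 : ContDiffOn ℝ 2 σ {x : E n | x ≠ 0})
    (hσconv : ConvexOn ℝ univ σ)
    (g : E n → ℝ → ℝ)
    (hgcont : ContinuousOn (fun q : E n × ℝ => g q.1 q.2) ({p : E n | ‖p‖ = 1} ×ˢ univ))
    (Lg : ℝ) (hLg : ∀ p : E n, ‖p‖ = 1 → ∀ ξ₁ ξ₂, |g p ξ₁ - g p ξ₂| ≤ Lg * |ξ₁ - ξ₂|)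
    (hgmono : ∀ p : E n, ‖p‖ = 1 → Monotone (g p))
    (f : E n → ℝ → ℝ)
    (hfcont : ContinuousOn (fun q : E n × ℝ => f q.1 q.2) (univ ×ˢ Icc 0 T))
    (Lf : ℝ) (hLf : ∀ t ∈ Icc (0:ℝ) T, ∀ x y, |f x t - f y t| ≤ Lf * ‖x - y‖)
    (u : E n → ℝ → ℝ)
    (hucont : ContinuousOn (fun q : E n × ℝ => u q.1 q.2) (univ ×ˢ Icc 0 T))
    (husol : IsViscSolnE σ g f (univ ×ˢ Ioo 0 T) u)
    (hconst : ∃ (R : ℝ) (c : ℝ), ∀ x : E n, ∀ t ∈ Icc (0:ℝ) T, R ≤ ‖x‖ → u x t = c)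
    (L : ℝ) (hL : ∀ x y, |u x 0 - u y 0| ≤ L * ‖x - y‖) :
    ∀ x y : E n, ∀ t ∈ Icc (0:ℝ) T,
      |u x t - u y t| ≤ L * Real.exp (Lg * Lf * t) * ‖x - y‖ := by
  obtain ⟨R, c, hc⟩ := hconst
  obtain ⟨p, hp⟩ : ∃ p : E n, ‖p‖ = 1 :=
    ⟨EuclideanSpace.single ⟨0, hn⟩ 1, by simp⟩
  have hLg0 : 0 ≤ Lg := by simpa using (abs_nonneg _).trans (hLg p hp 1 0)
  have hLf0 : 0 ≤ Lf := by
    simpa [hp] using (abs_nonneg _).trans (hLf 0 ⟨le_rfl, hT.le⟩ p 0)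
  have hL0 : 0 ≤ L := by simpa [hp] using (abs_nonneg _).trans (hL p 0)
  have hlt : ∀ x y : E n, ∀ t ∈ Ico (0 : ℝ) T,
      u x t - u y t ≤ L * Real.exp (Lg * Lf * t) * ‖x - y‖ := by
    intro x y t ht
    have hlim : Tendsto (fun A => A * Real.exp (Lg * Lf * t) * ‖x - y‖) (𝓝[>] L)
        (𝓝 (L * Real.exp (Lg * Lf * t) * ‖x - y‖)) :=
      (Continuous.tendsto (by fun_prop) L).mono_left nhdsWithin_le_nhds
    refine ge_of_tendsto hlim ?_
    filter_upwards [self_mem_nhdsWithin] with A hA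
    exact sub_le_of_viscSoln hσC2 hσconv hgcont hLg0 hLg hgmono hfcont hLf0 hLf hucont husol hc
      hL0 hL hA ht x y
  have hslice : ∀ x : E n, ContinuousOn (u x) (Icc 0 T) := fun x =>
    hucont.comp (f := fun t => (x, t)) (by fun_prop) fun t ht => ⟨mem_univ _, ht⟩
  have hle : ∀ x y : E n, ∀ t ∈ Icc (0 : ℝ) T,
      u x t - u y t ≤ L * Real.exp (Lg * Lf * t) * ‖x - y‖ := by
    intro x y t ht
    rw [← closure_Ico hT.ne] at ht
    refine ContinuousWithinAt.closure_le ht ?_ ?_ (hlt x y)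
    · have h := ((hslice x).sub (hslice y)) t (by rwa [closure_Ico hT.ne] at ht)
      exact h.mono Ico_subset_Icc_self
    · exact Continuous.continuousWithinAt (by fun_prop)
  intro x y t ht
  refine abs_le.mpr ⟨?_, hle x y t ht⟩
  have := hle y x t ht
  rw [norm_sub_rev] at this
  linarith

end Paper
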